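/- For every s ≥ 1, the Minkowski sum K̃(b^s) + K(c^s) is exactly the closed interval [ [0; b^s, 4, \overline{1,3}] + [0; c^s, 4, \overline{1,3}] , [0; b^s, 1, 2, \overline{1,3}] + [0; c^s, \overline{1,3}] ]. In particular, for s = 1, K(1,3) + K̃(1,4) = [ [0; 1,3,4, \overline{1,3}] + [0; 1,4,4, \overline{1,3}] , [0; \overline{1,3}] + [0; 1,4,1,2, \overline{1,3}] ] = [1.57041…, 1.61695…]. -/

import Mathlib

open Filter Set
open scoped Pointwise

noncomputable section

/-- The `n`-th convergent of the continued fraction `[0; a 0, a 1, a 2, …]`. -/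
def cfConv : ℕ → (ℕ → ℕ) → ℝ
  | 0, _ => 0
  | n + 1, a => 1 / (a 0 + cfConv n fun i => a (i + 1))

/-- The value `[0; a 0, a 1, a 2, …]` of the infinite continued fraction with
partial quotients `a 0, a 1, …` (the limit of its convergents). -/
def cfVal (a : ℕ → ℕ) : ℝ := limUnder atTop fun n => cfConv n a

/-- The sequence of partial quotients obtained by concatenating the finite word `b`
with the sequence `θ`. -/
def app (b : List ℕ) (θ : ℕ → ℕ) : ℕ → ℕ := fun n =>
  if h : n < b.length then b.get ⟨n, h⟩ else θ (n - b.length)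

/-- The forbidden pairs of consecutive partial quotients. -/
def badPairs : Set (ℕ × ℕ) := {(1, 4), (2, 4)}

/-- The set `D` of sequences with entries in `{1,2,3,4}` avoiding the pairs
`(1,4)` and `(2,4)`. -/
def Dset : Set (ℕ → ℕ) :=
  {θ | (∀ n, θ n ∈ ({1, 2, 3, 4} : Set ℕ)) ∧ ∀ n, (θ n, θ (n + 1)) ∉ badPairs}

/-- The Cantor set `K(b) = {[0; b, θ] : θ ∈ D, (b_s, θ_1) ∉ {(1,4),(2,4)}}`. -/
def Kb (b : List ℕ) : Set ℝ :=
  {x | ∃ θ ∈ Dset, (∀ d, b.getLast? = some d → (d, θ 0) ∉ badPairs) ∧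
    x = cfVal (app b θ)}

/-- The set `K̃(b) ⊆ K(b)` of values `[0; b, θ]` with moreover `(θ_1, θ_2) ≠ (1,3)`. -/
def Ktil (b : List ℕ) : Set ℝ :=
  {x | ∃ θ ∈ Dset, (∀ d, b.getLast? = some d → (d, θ 0) ∉ badPairs) ∧
    (θ 0, θ 1) ≠ (1, 3) ∧ x = cfVal (app b θ)}

/-- The word `b^s = (1,4)_s`. -/
def bW (s : ℕ) : List ℕ := (List.replicate s [1, 4]).flatten

/-- The word `c^s = (1,4)_{s-1}, 1, 3`. -/
def cW (s : ℕ) : List ℕ := bW (s - 1) ++ [1, 3]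

/-- The periodic sequence `\overline{1,3}`. -/
def per13 : ℕ → ℕ := fun n => if n % 2 = 0 then 1 else 3

/-- The periodic sequence `\overline{3,1}`. -/
def per31 : ℕ → ℕ := fun n => if n % 2 = 0 then 3 else 1

/-! ### Convergence of continued fractions with partial quotients in `{1, 2, 3, 4}` -/

/-- All partial quotients lie between `1` and `4`. -/
def IsDigitSeq (a : ℕ → ℕ) : Prop := ∀ n, 1 ≤ a n ∧ a n ≤ 4

lemma IsDigitSeq.tail {a : ℕ → ℕ} (h : IsDigitSeq a) : IsDigitSeq fun i => a (i + 1) :=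
  fun n => h (n + 1)

lemma abs_one_div_sub_one_div_le {d x y : ℝ} (hd : 1 ≤ d) (hx : 1 / 5 ≤ x) (hy : 1 / 5 ≤ y) :
    |1 / (d + x) - 1 / (d + y)| ≤ 25 / 36 * |x - y| := by
  have h : 1 / (d + x) - 1 / (d + y) = (y - x) / ((d + x) * (d + y)) := by
    field_simp
    ring
  have hpos : 36 / 25 ≤ (d + x) * (d + y) := by nlinarith
  rw [h, abs_div, abs_sub_comm y x, abs_of_pos (by linarith : 0 < (d + x) * (d + y)),
    div_le_iff₀ (by linarith)]
  nlinarith [abs_nonneg (x - y)]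

lemma cfConv_mem_Icc {a : ℕ → ℕ} (h : IsDigitSeq a) (n : ℕ) : cfConv n a ∈ Icc (0 : ℝ) 1 := by
  induction n generalizing a with
  | zero => simp [cfConv]
  | succ n ih =>
    obtain ⟨h0, h1⟩ := ih h.tail
    have hd : (1 : ℝ) ≤ a 0 := by exact_mod_cast (h 0).1
    refine ⟨by simp only [cfConv]; positivity, ?_⟩
    simp only [cfConv]
    rw [div_le_one (by linarith)]
    linarith

lemma one_fifth_le_cfConv {a : ℕ → ℕ} (h : IsDigitSeq a) {n : ℕ} (hn : 1 ≤ n) :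
    1 / 5 ≤ cfConv n a := by
  obtain ⟨n, rfl⟩ := Nat.exists_eq_add_of_le' hn
  obtain ⟨h0, h1⟩ := cfConv_mem_Icc h.tail n
  have hd : (1 : ℝ) ≤ a 0 := by exact_mod_cast (h 0).1
  have hd' : (a 0 : ℝ) ≤ 4 := by exact_mod_cast (h 0).2
  simp only [cfConv]
  exact one_div_le_one_div_of_le (by linarith) (by linarith)

lemma abs_cfConv_sub_cfConv_le {a b : ℕ → ℕ} (ha : IsDigitSeq a) (hb : IsDigitSeq b) {k m n : ℕ}
    (hm : k < m) (hn : k < n) (hab : ∀ i < k, a i = b i) :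
    |cfConv m a - cfConv n b| ≤ (25 / 36) ^ k := by
  induction k generalizing a b m n with
  | zero =>
    obtain ⟨h1, h2⟩ := cfConv_mem_Icc ha m
    obtain ⟨h3, h4⟩ := cfConv_mem_Icc hb n
    rw [abs_le]
    constructor <;> norm_num <;> linarith
  | succ k ih =>
    obtain ⟨m, rfl⟩ := Nat.exists_eq_add_of_le' (Nat.one_le_of_lt hm)
    obtain ⟨n, rfl⟩ := Nat.exists_eq_add_of_le' (Nat.one_le_of_lt hn)
    have hd : (1 : ℝ) ≤ a 0 := by exact_mod_cast (ha 0).1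
    have ih' := ih ha.tail hb.tail (m := m) (n := n) (by omega) (by omega)
      fun i hi => hab (i + 1) (by omega)
    simp only [cfConv, ← hab 0 (by omega)]
    refine (abs_one_div_sub_one_div_le hd (one_fifth_le_cfConv ha.tail (by omega))
      (one_fifth_le_cfConv hb.tail (by omega))).trans ?_
    rw [pow_succ]
    linarith

lemma tendsto_cfConv {a : ℕ → ℕ} (h : IsDigitSeq a) :
    Tendsto (fun n => cfConv n a) atTop (nhds (cfVal a)) := by
  have hpow : Tendsto (fun k : ℕ => (25 / 36 : ℝ) ^ k) atTop (nhds 0) :=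
    tendsto_pow_atTop_nhds_zero_of_lt_one (by norm_num) (by norm_num)
  have hc : CauchySeq fun n => cfConv n a := by
    rw [Metric.cauchySeq_iff]
    intro ε hε
    obtain ⟨k, hk⟩ := (hpow.eventually_lt_const hε).exists
    refine ⟨k + 1, fun m hm n hn => ?_⟩
    rw [Real.dist_eq]
    exact (abs_cfConv_sub_cfConv_le h h (by omega) (by omega) fun _ _ => rfl).trans_lt hk
  exact tendsto_nhds_limUnder (cauchySeq_tendsto_of_complete hc)

lemma cfVal_eq {a : ℕ → ℕ} (h : IsDigitSeq a) :
    cfVal a = 1 / (a 0 + cfVal fun i => a (i + 1)) := by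
  have hd : (1 : ℝ) ≤ a 0 := by exact_mod_cast (h 0).1
  have ht := tendsto_cfConv h.tail
  have h0 : 0 ≤ cfVal fun i => a (i + 1) :=
    ge_of_tendsto' ht fun n => (cfConv_mem_Icc h.tail n).1
  refine tendsto_nhds_unique ((tendsto_add_atTop_iff_nat 1).2 (tendsto_cfConv h)) ?_
  exact tendsto_const_nhds.div (tendsto_const_nhds.add ht) (by linarith)

lemma one_fifth_le_cfVal {a : ℕ → ℕ} (h : IsDigitSeq a) : 1 / 5 ≤ cfVal a :=
  ge_of_tendsto (tendsto_cfConv h)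
    ((eventually_ge_atTop 1).mono fun _ hn => one_fifth_le_cfConv h hn)

lemma cfVal_le_one {a : ℕ → ℕ} (h : IsDigitSeq a) : cfVal a ≤ 1 :=
  le_of_tendsto' (tendsto_cfConv h) fun n => (cfConv_mem_Icc h n).2

lemma abs_cfVal_sub_cfVal_le {a b : ℕ → ℕ} (ha : IsDigitSeq a) (hb : IsDigitSeq b) {k : ℕ}
    (hab : ∀ i < k, a i = b i) : |cfVal a - cfVal b| ≤ (25 / 36) ^ k :=
  le_of_tendsto ((tendsto_cfConv ha).sub (tendsto_cfConv hb)).abs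
    ((eventually_gt_atTop k).mono fun _ hn => abs_cfConv_sub_cfConv_le ha hb hn hn hab)

lemma continuousOn_cfVal : ContinuousOn cfVal {a | IsDigitSeq a} := by
  intro a ha
  rw [ContinuousWithinAt, Metric.tendsto_nhds]
  intro ε hε
  have hpow : Tendsto (fun k : ℕ => (25 / 36 : ℝ) ^ k) atTop (nhds 0) :=
    tendsto_pow_atTop_nhds_zero_of_lt_one (by norm_num) (by norm_num)
  obtain ⟨k, hk⟩ := (hpow.eventually_lt_const hε).exists
  have hev : ∀ᶠ b in nhds a, ∀ i < k, b i = a i := by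
    have : ∀ i ∈ Finset.range k, ∀ᶠ b in nhds a, b i = a i := fun i _ =>
      (continuous_apply i).continuousAt.eventually (eventually_of_mem
        ((isOpen_discrete {a i}).mem_nhds rfl) fun _ h => h)
    simpa using (Filter.eventually_all_finset (Finset.range k)).2 this
  filter_upwards [mem_nhdsWithin_of_mem_nhds hev, self_mem_nhdsWithin] with b hb hbd
  rw [Real.dist_eq]
  exact (abs_cfVal_sub_cfVal_le hbd ha hb).trans_lt hk

/-! ### Concatenation of words and sequences -/

lemma app_nil (θ : ℕ → ℕ) : app [] θ = θ := by
  ext n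
  simp [app]

lemma app_cons_zero (d : ℕ) (w : List ℕ) (θ : ℕ → ℕ) : app (d :: w) θ 0 = d := by
  simp [app]

lemma app_cons_succ (d : ℕ) (w : List ℕ) (θ : ℕ → ℕ) (n : ℕ) :
    app (d :: w) θ (n + 1) = app w θ n := by
  simp [app]

/-- The inverse branch `x ↦ [0; w, x]` of the Gauss map attached to a word `w`. -/
def cfBranch (w : List ℕ) (x : ℝ) : ℝ := w.foldr (fun d y => 1 / (d + y)) x

lemma isDigitSeq_app {w : List ℕ} {θ : ℕ → ℕ} (hw : ∀ d ∈ w, 1 ≤ d ∧ d ≤ 4)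
    (hθ : IsDigitSeq θ) : IsDigitSeq (app w θ) := by
  intro n
  unfold app
  split
  · exact hw _ (List.get_mem _ _)
  · exact hθ _

lemma cfVal_app {w : List ℕ} {θ : ℕ → ℕ} (hw : ∀ d ∈ w, 1 ≤ d ∧ d ≤ 4) (hθ : IsDigitSeq θ) :
    cfVal (app w θ) = cfBranch w (cfVal θ) := by
  induction w with
  | nil => simp [app_nil, cfBranch]
  | cons d w ih =>
    rw [cfVal_eq (isDigitSeq_app hw hθ)]
    simp only [app_cons_zero, app_cons_succ]
    rw [ih fun e he => hw e (List.mem_cons_of_mem _ he)]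
    rfl

lemma cfBranch_append (v w : List ℕ) (x : ℝ) :
    cfBranch (v ++ w) x = cfBranch v (cfBranch w x) := by
  simp [cfBranch]

lemma bW_succ (n : ℕ) : bW (n + 1) = bW n ++ [1, 4] := by
  simp [bW, List.replicate_succ']

lemma digit_of_mem_bW {n d : ℕ} (h : d ∈ bW n) : 1 ≤ d ∧ d ≤ 4 := by
  simp only [bW, List.mem_flatten, List.mem_replicate] at h
  obtain ⟨l, ⟨-, rfl⟩, h⟩ := h
  simp at h
  omega

/-! ### The sequences in `Dset` -/

lemma isDigitSeq_of_mem_Dset {θ : ℕ → ℕ} (h : θ ∈ Dset) : IsDigitSeq θ := by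
  intro n
  have := h.1 n
  simp only [mem_insert_iff, mem_singleton_iff] at this
  omega

lemma tail_mem_Dset {θ : ℕ → ℕ} (h : θ ∈ Dset) : (fun i => θ (i + 1)) ∈ Dset :=
  ⟨fun n => h.1 (n + 1), fun n => h.2 (n + 1)⟩

lemma cons_mem_Dset {θ : ℕ → ℕ} (h : θ ∈ Dset) {d : ℕ} (hd : 1 ≤ d ∧ d ≤ 4)
    (hbad : (d, θ 0) ∉ badPairs) : app [d] θ ∈ Dset := by
  constructor
  · rintro (_ | n)
    · rw [app_cons_zero]
      simp only [mem_insert_iff, mem_singleton_iff]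
      omega
    · rw [app_cons_succ, app_nil]
      exact h.1 n
  · rintro (_ | n)
    · rwa [app_cons_zero, app_cons_succ, app_nil]
    · simpa only [app_cons_succ, app_nil] using h.2 n

lemma cfVal_cons {θ : ℕ → ℕ} (h : θ ∈ Dset) {d : ℕ} (hd : 1 ≤ d ∧ d ≤ 4) :
    cfVal (app [d] θ) = 1 / (d + cfVal θ) := by
  rw [cfVal_app (by simpa using hd) (isDigitSeq_of_mem_Dset h)]
  rfl

lemma isCompact_Dset : IsCompact Dset := by
  have hc : IsCompact (univ.pi fun _ : ℕ => ({1, 2, 3, 4} : Set ℕ)) :=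
    isCompact_univ_pi fun _ => (by simp : ({1, 2, 3, 4} : Set ℕ).Finite).isCompact
  refine hc.of_isClosed_subset ?_ fun θ h n _ => h.1 n
  have hcl : ∀ n, IsClosed {θ : ℕ → ℕ | (θ n, θ (n + 1)) ∉ badPairs} := fun n =>
    (isClosed_discrete badPairsᶜ).preimage
      ((continuous_apply n).prodMk (continuous_apply (n + 1)) :
        Continuous fun θ : ℕ → ℕ => (θ n, θ (n + 1)))
  have hcl' : ∀ n, IsClosed {θ : ℕ → ℕ | θ n ∈ ({1, 2, 3, 4} : Set ℕ)} := fun n =>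
    (isClosed_discrete _).preimage (continuous_apply n)
  have h : Dset = (⋂ n, {θ : ℕ → ℕ | θ n ∈ ({1, 2, 3, 4} : Set ℕ)}) ∩
      ⋂ n, {θ : ℕ → ℕ | (θ n, θ (n + 1)) ∉ badPairs} := by
    ext θ
    simp [Dset]
  rw [h]
  exact (isClosed_iInter hcl').inter (isClosed_iInter hcl)

lemma per13_mem_Dset : per13 ∈ Dset := by
  constructor <;> intro n <;> rcases Nat.mod_two_eq_zero_or_one n with h | h <;>
    simp [per13, badPairs, h, Nat.add_mod]

lemma per31_mem_Dset : per31 ∈ Dset := by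
  constructor <;> intro n <;> rcases Nat.mod_two_eq_zero_or_one n with h | h <;>
    simp [per31, badPairs, h, Nat.add_mod]

lemma per13_eq_app : app [1, 3] per13 = per13 := by
  ext n
  rcases n with _ | _ | n
  · rfl
  · rfl
  · simp [app_cons_succ, app_nil, per13, add_assoc]

lemma per31_eq_app : app [3] per13 = per31 := by
  ext n
  rcases n with _ | n
  · rfl
  · rw [app_cons_succ, app_nil]
    rcases Nat.mod_two_eq_zero_or_one n with h | h <;> simp [per13, per31, h, Nat.add_mod]

/-! ### The value of `[0; 1, 3, 1, 3, …]` -/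

/-- The number `[0; 1, 3, 1, 3, …] = (√21 - 3) / 2`. -/
def omax : ℝ := cfVal per13

lemma omax_sq : omax ^ 2 = 3 - 3 * omax := by
  have hd := isDigitSeq_of_mem_Dset per13_mem_Dset
  have h0 : 1 / 5 ≤ omax := one_fifth_le_cfVal hd
  have h : omax = 1 / (1 + 1 / (3 + omax)) := by
    have := cfVal_app (w := [1, 3]) (by simp) hd
    rw [per13_eq_app] at this
    simpa [cfBranch, omax] using this
  have h3 : 3 + omax ≠ 0 := by linarith
  have h4 : 1 + 1 / (3 + omax) ≠ 0 := by positivity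
  rw [eq_div_iff h4] at h
  field_simp at h
  linarith

lemma omax_cube : omax ^ 3 = 12 * omax - 9 := by
  linear_combination (omax - 3) * omax_sq

lemma omax_gt : 0.791287 < omax := by
  have h0 : 1 / 5 ≤ omax := one_fifth_le_cfVal (isDigitSeq_of_mem_Dset per13_mem_Dset)
  nlinarith [omax_sq]

lemma omax_lt : omax < 0.791288 := by
  have h0 : 1 / 5 ≤ omax := one_fifth_le_cfVal (isDigitSeq_of_mem_Dset per13_mem_Dset)
  nlinarith [omax_sq]

lemma cfVal_per31 : cfVal per31 = omax / 3 := by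
  rw [← per31_eq_app, cfVal_cons per13_mem_Dset (by simp)]
  change 1 / (3 + omax) = omax / 3
  have := omax_gt
  rw [div_eq_iff (by linarith)]
  linarith [omax_sq]

lemma one_div_add_le {d x y e : ℝ} (hd : 1 ≤ d) (hx : 1 / 5 ≤ x) (hy : 1 / 5 ≤ y) (he : 0 ≤ e)
    (h : y - e ≤ x) : 1 / (d + x) ≤ 1 / (d + y) + 25 / 36 * e := by
  rcases le_total y x with hxy | hxy
  · have := one_div_le_one_div_of_le (by linarith) (by linarith : d + y ≤ d + x)
    linarith
  · have := (le_abs_self _).trans (abs_one_div_sub_one_div_le hd hx hy)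
    rw [abs_sub_comm, abs_of_nonneg (by linarith : 0 ≤ y - x)] at this
    linarith

/-- Approximate form of `cfVal_le_omax` and `one_sub_omax_le_cfVal`. -/
lemma cfVal_bounds_approx (n : ℕ) {θ : ℕ → ℕ} (h : θ ∈ Dset) :
    cfVal θ ≤ omax + (25 / 36) ^ n ∧ 1 - omax - (25 / 36) ^ n ≤ cfVal θ ∧
      (θ 0 ≤ 3 → omax / 3 - (25 / 36) ^ n ≤ cfVal θ) := by
  have ha := omax_gt
  have hb := omax_lt
  have hs := omax_sq
  induction n generalizing θ with
  | zero =>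
    have h1 := one_fifth_le_cfVal (isDigitSeq_of_mem_Dset h)
    have h2 := cfVal_le_one (isDigitSeq_of_mem_Dset h)
    norm_num
    exact ⟨by linarith, by linarith, fun _ => by linarith⟩
  | succ n ih =>
    have hdig := isDigitSeq_of_mem_Dset h
    have hd : (1 : ℝ) ≤ θ 0 := by exact_mod_cast (hdig 0).1
    have hd4 : (θ 0 : ℝ) ≤ 4 := by exact_mod_cast (hdig 0).2
    obtain ⟨h1, h2, h3⟩ := ih (tail_mem_Dset h)
    have hx := one_fifth_le_cfVal hdig.tail
    have hv := cfVal_eq hdig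
    set x := cfVal fun i => θ (i + 1)
    have he : (0 : ℝ) ≤ (25 / 36) ^ n := by positivity
    rw [pow_succ, mul_comm]
    set e : ℝ := (25 / 36) ^ n
    have hlow : 1 / (θ 0 + omax) ≤ 1 / (θ 0 + x) + 25 / 36 * e :=
      one_div_add_le hd (by linarith) hx he (by linarith)
    rw [hv]
    refine ⟨?_, ?_, fun h0 => ?_⟩
    · by_cases hc : θ 0 ≤ 2
      · have hbad : θ (0 + 1) ≤ 3 := by
          have h4 := (hdig 1).2
          have h5 := h.2 0
          have h6 := (hdig 0).1
          by_contra hcon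
          apply h5
          simp only [badPairs, mem_insert_iff, mem_singleton_iff, Prod.mk.injEq, zero_add] at hcon ⊢
          omega
        have := one_div_add_le hd hx (by linarith) he (h3 hbad)
        have h5 : 1 / ((θ 0 : ℝ) + omax / 3) ≤ omax := by
          rw [div_le_iff₀ (by linarith)]
          nlinarith
        linarith
      · have h3' : (3 : ℝ) ≤ θ 0 := by exact_mod_cast (by omega : 3 ≤ θ 0)
        have h5 : 1 / ((θ 0 : ℝ) + x) ≤ omax := by
          rw [div_le_iff₀ (by linarith)]
          nlinarith
        linarith
    · have h5 : 1 - omax ≤ 1 / ((θ 0 : ℝ) + omax) := by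
        rw [le_div_iff₀ (by linarith)]
        nlinarith
      linarith
    · have h3' : (θ 0 : ℝ) ≤ 3 := by exact_mod_cast h0
      have h5 : omax / 3 ≤ 1 / ((θ 0 : ℝ) + omax) := by
        rw [le_div_iff₀ (by linarith)]
        nlinarith
      linarith

lemma tendsto_const_add_pow (c : ℝ) :
    Tendsto (fun n : ℕ => c + (25 / 36 : ℝ) ^ n) atTop (nhds c) := by
  simpa using tendsto_const_nhds.add
    (tendsto_pow_atTop_nhds_zero_of_lt_one (by norm_num : (0 : ℝ) ≤ 25 / 36) (by norm_num))

lemma cfVal_le_omax {θ : ℕ → ℕ} (h : θ ∈ Dset) : cfVal θ ≤ omax :=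
  ge_of_tendsto' (tendsto_const_add_pow _) fun n => (cfVal_bounds_approx n h).1

lemma one_sub_omax_le_cfVal {θ : ℕ → ℕ} (h : θ ∈ Dset) : 1 - omax ≤ cfVal θ :=
  ge_of_tendsto' (tendsto_const_add_pow _) fun n => by linarith [(cfVal_bounds_approx n h).2.1]

/-- The largest value that avoids the prefix `1, 3` is `[0; 1, 2, 1, 3, 1, 3, …]`. -/
lemma cfVal_le_of_ne {θ : ℕ → ℕ} (h : θ ∈ Dset) (h13 : (θ 0, θ 1) ≠ (1, 3)) :
    cfVal θ ≤ 1 - omax / 3 := by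
  have ha := omax_gt
  have hb := omax_lt
  have hs := omax_sq
  have hdig := isDigitSeq_of_mem_Dset h
  have hx := one_fifth_le_cfVal hdig.tail
  have hd : 1 ≤ θ 0 := (hdig 0).1
  rw [cfVal_eq hdig]
  rcases hd.eq_or_lt with h0 | h0
  · have h1 : θ 1 ≤ 2 := by
      have h4 := (hdig 1).2
      have h5 : (θ 0, θ 1) ∉ badPairs := h.2 0
      simp only [badPairs, mem_insert_iff, mem_singleton_iff, Prod.mk.injEq, ne_eq] at h5 h13
      omega
    have h2 : (θ 1 : ℝ) ≤ 2 := by exact_mod_cast h1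
    have h1' : (1 : ℝ) ≤ θ 1 := by exact_mod_cast (hdig 1).1
    have hy := cfVal_le_omax (tail_mem_Dset (tail_mem_Dset h))
    have hy' := one_fifth_le_cfVal hdig.tail.tail
    have hv := cfVal_eq hdig.tail
    simp only [zero_add] at hv
    have h3 : (omax + 1) / 5 ≤ cfVal fun i => θ (i + 1) := by
      rw [hv, le_div_iff₀ (by linarith)]
      nlinarith
    rw [← h0, div_le_iff₀ (by push_cast; linarith)]
    push_cast
    nlinarith
  · have : (2 : ℝ) ≤ θ 0 := by exact_mod_cast h0
    rw [div_le_iff₀ (by linarith)]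
    nlinarith

/-! ### Sums of Cantor sets given by trees of intervals -/

section HallTree

variable {N : Type*} (L R g : N → ℝ) (X : N → Set ℝ)

/-- The node `a` (left) and the node `b` (right) are obtained from `n` by removing an open gap of
length `g n` that is at most as long as both remaining intervals, whose own gaps are not longer. -/
structure IsHallSplit (n a b : N) : Prop where
  left_eq : L a = L n
  gap_eq : R a + g n = L b
  right_eq : R b = R n
  subset_left : X a ⊆ X n
  subset_right : X b ⊆ X n
  gap_le_left : g n ≤ R a - L a
  gap_le_right : g n ≤ R b - L b
  left_gap_le : g a ≤ g n
  right_gap_le : g b ≤ g n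

variable {L R g X}

lemma exists_hallSplit_step (hsplit : ∀ n, ∃ a b, IsHallSplit L R g X n a b) {C : ℝ}
    (hg : ∀ n, 0 < g n) (hC : ∀ n, R n - L n ≤ C * g n) {I J : N} (hIJ : g I ≤ R J - L J)
    (hJI : g J ≤ g I) {z : ℝ} (hz : z ∈ Icc (L I + L J) (R I + R J)) :
    ∃ I', X I' ⊆ X I ∧ g I' ≤ R J - L J ∧ g J ≤ R I' - L I' ∧
      z ∈ Icc (L I' + L J) (R I' + R J) ∧
      C * ((R I' - L I') * (R J - L J)) ≤ (C - 1) * ((R I - L I) * (R J - L J)) := by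
  obtain ⟨a, b, h⟩ := hsplit I
  have h1 := h.left_eq
  have h2 := h.gap_eq
  have h3 := h.right_eq
  have h4 := h.gap_le_left
  have h5 := h.gap_le_right
  have h6 := h.left_gap_le
  have h7 := h.right_gap_le
  have hgI := hg I
  have hCI := hC I
  have hCpos : 0 ≤ C := by
    by_contra hcon
    nlinarith
  rcases le_total z (R a + R J) with hza | hza
  · refine ⟨a, h.subset_left, by linarith, by linarith, ⟨by linarith [hz.1], hza⟩, ?_⟩
    have : C * (R a - L a) ≤ (C - 1) * (R I - L I) := by nlinarith
    nlinarith
  · refine ⟨b, h.subset_right, by linarith, by linarith, ⟨by linarith, by linarith [hz.2]⟩, ?_⟩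
    have : C * (R b - L b) ≤ (C - 1) * (R I - L I) := by nlinarith
    nlinarith

lemma exists_add_approx (hX : ∀ n, ∃ x ∈ X n, x ∈ Icc (L n) (R n))
    (hsplit : ∀ n, ∃ a b, IsHallSplit L R g X n a b) {C : ℝ} (hC1 : 1 ≤ C)
    (hg : ∀ n, 0 < g n) (hC : ∀ n, R n - L n ≤ C * g n) (k : ℕ) {I J : N}
    (hIJ : g I ≤ R J - L J) (hJI : g J ≤ R I - L I) {z : ℝ}
    (hz : z ∈ Icc (L I + L J) (R I + R J)) :
    ∃ x ∈ X I, ∃ y ∈ X J,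
      (z - (x + y)) ^ 2 ≤ 4 * C * ((C - 1) / C) ^ k * ((R I - L I) * (R J - L J)) := by
  have hκ : 0 ≤ (C - 1) / C := div_nonneg (by linarith) (by linarith)
  have hstep : ∀ (k : ℕ) {s t : ℝ}, C * s ≤ (C - 1) * t →
      4 * C * ((C - 1) / C) ^ k * s ≤ 4 * C * ((C - 1) / C) ^ (k + 1) * t := by
    intro k s t h
    have h' : s ≤ (C - 1) / C * t := by
      rw [div_mul_eq_mul_div, le_div_iff₀ (by linarith)]
      linarith
    calc _ ≤ 4 * C * ((C - 1) / C) ^ k * ((C - 1) / C * t) :=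
          mul_le_mul_of_nonneg_left h' (by positivity)
      _ = _ := by ring
  induction k generalizing I J with
  | zero =>
    obtain ⟨x, hx, hx1, hx2⟩ := hX I
    obtain ⟨y, hy, hy1, hy2⟩ := hX J
    refine ⟨x, hx, y, hy, ?_⟩
    obtain ⟨hz1, hz2⟩ := hz
    have hI : R I - L I ≤ C * (R J - L J) := (hC I).trans (by gcongr)
    have hJ : R J - L J ≤ C * (R I - L I) := (hC J).trans (by gcongr)
    have hIpos : 0 < R I - L I := (hg J).trans_le hJI
    have hJpos : 0 < R J - L J := (hg I).trans_le hIJ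
    have habs : (z - (x + y)) ^ 2 ≤ ((R I - L I) + (R J - L J)) ^ 2 :=
      sq_le_sq' (by linarith) (by linarith)
    rw [pow_zero, mul_one]
    nlinarith [sq_nonneg ((R I - L I) - (R J - L J)), mul_pos hIpos hJpos,
      mul_le_mul_of_nonneg_left hI hIpos.le, mul_le_mul_of_nonneg_left hJ hJpos.le]
  | succ k ih =>
    rcases le_total (g J) (g I) with h | h
    · obtain ⟨I', hsub, h1, h2, h3, h4⟩ := exists_hallSplit_step hsplit hg hC hIJ h hz
      obtain ⟨x, hx, y, hy, hxy⟩ := ih h1 h2 h3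
      exact ⟨x, hsub hx, y, hy, hxy.trans (hstep k h4)⟩
    · rw [add_comm (L I), add_comm (R I)] at hz
      obtain ⟨J', hsub, h1, h2, h3, h4⟩ := exists_hallSplit_step hsplit hg hC hJI h hz
      rw [add_comm (L J'), add_comm (R J')] at h3
      obtain ⟨x, hx, y, hy, hxy⟩ := ih h2 h1 h3
      refine ⟨x, hx, y, hsub hy, hxy.trans (hstep k ?_)⟩
      linarith

/-- A pair of intervals of the tree, each at least as long as the gap of the other one, has a sum
in which the sum of the two Cantor sets is dense. -/
theorem Icc_subset_closure_add (hX : ∀ n, ∃ x ∈ X n, x ∈ Icc (L n) (R n))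
    (hsplit : ∀ n, ∃ a b, IsHallSplit L R g X n a b) {C : ℝ} (hC1 : 1 ≤ C)
    (hg : ∀ n, 0 < g n) (hC : ∀ n, R n - L n ≤ C * g n) {I J : N}
    (hIJ : g I ≤ R J - L J) (hJI : g J ≤ R I - L I) :
    Icc (L I + L J) (R I + R J) ⊆ closure (X I + X J) := by
  intro z hz
  rw [Metric.mem_closure_iff]
  intro ε hε
  have hlim : Tendsto (fun k : ℕ => 4 * C * ((C - 1) / C) ^ k * ((R I - L I) * (R J - L J)))
      atTop (nhds (4 * C * 0 * ((R I - L I) * (R J - L J)))) :=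
    ((tendsto_pow_atTop_nhds_zero_of_lt_one (div_nonneg (by linarith) (by linarith))
      (by rw [div_lt_one] <;> linarith)).const_mul _).mul_const _
  obtain ⟨k, hk⟩ := (hlim.eventually_lt_const (u := ε ^ 2) (by simpa using pow_pos hε 2)).exists
  obtain ⟨x, hx, y, hy, hxy⟩ := exists_add_approx hX hsplit hC1 hg hC k hIJ hJI hz
  refine ⟨x + y, add_mem_add hx hy, ?_⟩
  rw [Real.dist_eq]
  exact abs_lt_of_sq_lt_sq (hxy.trans_lt hk) hε.le

end HallTree

/-! ### Möbius maps -/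

/-- A Möbius map `x ↦ (p + p' x) / (q + q' x)` of determinant `±1` with `0 ≤ q' ≤ q`, `0 < q`. -/
structure Mob where
  (p p' q q' : ℝ)
  q_pos : 0 < q
  q'_nonneg : 0 ≤ q'
  q'_le : q' ≤ q
  det : p' * q - p * q' = 1 ∨ p' * q - p * q' = -1

namespace Mob

/-- The value of a Möbius map. -/
def ev (f : Mob) (x : ℝ) : ℝ := (f.p + f.p' * x) / (f.q + f.q' * x)

/-- The length of the image of `[x, y]`. -/
def len (f : Mob) (x y : ℝ) : ℝ := (y - x) / ((f.q + f.q' * x) * (f.q + f.q' * y))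

lemma denom_pos (f : Mob) {x : ℝ} (hx : 0 ≤ x) : 0 < f.q + f.q' * x :=
  add_pos_of_pos_of_nonneg f.q_pos (mul_nonneg f.q'_nonneg hx)

lemma len_pos (f : Mob) {x y : ℝ} (hx : 0 ≤ x) (hxy : x < y) : 0 < f.len x y :=
  div_pos (by linarith) (mul_pos (f.denom_pos hx) (f.denom_pos (by linarith)))

lemma ev_sub_ev (f : Mob) {x y : ℝ} (hx : 0 ≤ x) (hy : 0 ≤ y) :
    f.ev y - f.ev x = (f.p' * f.q - f.p * f.q') * f.len x y := by
  have h1 := (f.denom_pos hx).ne'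
  have h2 := (f.denom_pos hy).ne'
  rw [ev, ev, len, div_sub_div _ _ h2 h1, mul_div_assoc']
  congr 1 <;> ring

lemma max_sub_min_ev (f : Mob) {x y : ℝ} (hx : 0 ≤ x) (hxy : x < y) :
    max (f.ev x) (f.ev y) - min (f.ev x) (f.ev y) = f.len x y := by
  rw [max_sub_min_eq_abs', abs_sub_comm, f.ev_sub_ev hx (hx.trans hxy.le)]
  have := f.len_pos hx hxy
  rcases f.det with h | h <;> rw [h]
  · rw [one_mul, abs_of_pos this]
  · rw [neg_one_mul, abs_neg, abs_of_pos this]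

lemma ev_mem_Icc (f : Mob) {x y z : ℝ} (hx : 0 ≤ x) (hz : z ∈ Icc x y) :
    f.ev z ∈ Icc (min (f.ev x) (f.ev y)) (max (f.ev x) (f.ev y)) := by
  have hz0 := hx.trans hz.1
  have h1 := f.ev_sub_ev hx hz0
  have h2 := f.ev_sub_ev hz0 (hz0.trans hz.2)
  have h3 : 0 ≤ f.len x z := div_nonneg (by linarith [hz.1])
    (mul_pos (f.denom_pos hx) (f.denom_pos hz0)).le
  have h4 : 0 ≤ f.len z y := div_nonneg (by linarith [hz.2])
    (mul_pos (f.denom_pos hz0) (f.denom_pos (hz0.trans hz.2))).le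
  rcases f.det with h | h <;> rw [h] at h1 h2
  · exact ⟨(min_le_left _ _).trans (by linarith), le_trans (by linarith) (le_max_right _ _)⟩
  · exact ⟨(min_le_right _ _).trans (by linarith), le_trans (by linarith) (le_max_left _ _)⟩

/-- The Möbius map `x ↦ f (1 / (d + x))`. -/
def push (f : Mob) (d : ℕ) (hd : 1 ≤ d := by norm_num) : Mob where
  p := f.p * d + f.p'
  p' := f.p
  q := f.q * d + f.q'
  q' := f.q
  q_pos := add_pos_of_pos_of_nonneg (mul_pos f.q_pos (by exact_mod_cast hd)) f.q'_nonneg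
  q'_nonneg := f.q_pos.le
  q'_le := by
    have : (1 : ℝ) ≤ d := by exact_mod_cast hd
    nlinarith [f.q_pos, f.q'_nonneg]
  det := by
    rcases f.det with h | h
    · right
      linear_combination -h
    · left
      linear_combination -h

lemma ev_push (f : Mob) {d : ℕ} (hd : 1 ≤ d) {x y : ℝ} (hx : 0 ≤ x) (h : (d + x) * y = 1) :
    (f.push d hd).ev x = f.ev y := by
  have hd0 : (0 : ℝ) < d + x := add_pos_of_pos_of_nonneg (by exact_mod_cast hd) hx
  obtain rfl : y = 1 / (d + x) := by rw [eq_div_iff hd0.ne']; linarith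
  have h1 := (f.denom_pos (one_div_nonneg.2 hd0.le)).ne'
  have h2 := ((f.push d hd).denom_pos hx).ne'
  simp only [push] at h2
  simp only [ev, push]
  rw [div_eq_div_iff h2 h1]
  field_simp
  ring

lemma ev_push_eq (f : Mob) {d : ℕ} (hd : 1 ≤ d) {x : ℝ} (hx : 0 ≤ x) :
    (f.push d hd).ev x = f.ev (1 / (d + x)) :=
  f.ev_push hd hx
    (mul_one_div_cancel (add_pos_of_pos_of_nonneg (by exact_mod_cast hd) hx).ne')

lemma len_push (f : Mob) {d : ℕ} (hd : 1 ≤ d) {x y x' y' : ℝ} (hx : 0 ≤ x) (hy : 0 ≤ y)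
    (h : (d + x) * y' = 1) (h' : (d + y) * x' = 1) :
    (f.push d hd).len x y = f.len x' y' := by
  have hdx : (0 : ℝ) < d + x := add_pos_of_pos_of_nonneg (by exact_mod_cast hd) hx
  have hdy : (0 : ℝ) < d + y := add_pos_of_pos_of_nonneg (by exact_mod_cast hd) hy
  obtain rfl : y' = 1 / (d + x) := by rw [eq_div_iff hdx.ne']; linarith
  obtain rfl : x' = 1 / (d + y) := by rw [eq_div_iff hdy.ne']; linarith
  have h1 := (f.denom_pos (one_div_nonneg.2 hdx.le)).ne'
  have h2 := (f.denom_pos (one_div_nonneg.2 hdy.le)).ne'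
  have h3 := ((f.push d hd).denom_pos hx).ne'
  have h4 := ((f.push d hd).denom_pos hy).ne'
  simp only [push] at h3 h4
  simp only [len, push]
  rw [div_eq_div_iff (mul_ne_zero h3 h4) (mul_ne_zero h2 h1)]
  field_simp
  ring

/-- It suffices to compare lengths coefficientwise (after Abel summation) in `q, q'`. -/
lemma len_le_mul_len (f : Mob) {c x y x' y' : ℝ} (hx : 0 ≤ x) (hy : 0 ≤ y) (hx' : 0 ≤ x')
    (hy' : 0 ≤ y') (h0 : y - x ≤ c * (y' - x'))
    (h1 : (y - x) * (1 + x' + y') ≤ c * (y' - x') * (1 + x + y))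
    (h2 : (y - x) * ((1 + x') * (1 + y')) ≤ c * (y' - x') * ((1 + x) * (1 + y))) :
    f.len x y ≤ c * f.len x' y' := by
  have hq := f.q_pos
  have hq' := f.q'_nonneg
  have hle := f.q'_le
  rw [len, len, mul_div_assoc', div_le_div_iff₀ (mul_pos (f.denom_pos hx) (f.denom_pos hy))
    (mul_pos (f.denom_pos hx') (f.denom_pos hy'))]
  linear_combination f.q * (f.q - f.q') * h0 + f.q' * (f.q - f.q') * h1 + f.q' ^ 2 * h2

lemma len_le_len (f : Mob) {x y x' y' : ℝ} (hx : 0 ≤ x) (hy : 0 ≤ y) (hx' : 0 ≤ x')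
    (hy' : 0 ≤ y') (h0 : y - x ≤ y' - x')
    (h1 : (y - x) * (1 + x' + y') ≤ (y' - x') * (1 + x + y))
    (h2 : (y - x) * ((1 + x') * (1 + y')) ≤ (y' - x') * ((1 + x) * (1 + y))) :
    f.len x y ≤ f.len x' y' := by
  simpa using f.len_le_mul_len (c := 1) hx hy hx' hy' (by linarith) (by linarith) (by linarith)

end Mob

/-! ### The interval tree of the Cantor sets -/

/-- The admissible sets of next partial quotients: `{1, 2, 3}`, `{1, 2, 3, 4}`, `{2, 3}`,
`{2, 3, 4}` and `{3, 4}`. -/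
inductive DigitRange
  | d123 | d1234 | d23 | d234 | d34

namespace DigitRange

/-- The smallest digit. -/
def dmin : DigitRange → ℕ
  | d123 => 1 | d1234 => 1 | d23 => 2 | d234 => 2 | d34 => 3

/-- The largest digit. -/
def dmax : DigitRange → ℕ
  | d123 => 3 | d1234 => 4 | d23 => 3 | d234 => 4 | d34 => 4

/-- The minimum of the values whose first digit is in the range. -/
def lo : DigitRange → ℝ
  | d123 => omax / 3 | d1234 => 1 - omax | d23 => omax / 3 | d234 => 1 - omax | d34 => 1 - omax

/-- The maximum of the values whose first digit is in the range. -/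
def hi : DigitRange → ℝ
  | d123 => omax | d1234 => omax | d23 => (3 - omax) / 5 | d234 => (3 - omax) / 5
  | d34 => (omax + 7) / 25

/-- The left end of the gap between the smallest digit and the others. -/
def gapLo : DigitRange → ℝ
  | d123 => (3 - omax) / 5 | d1234 => (3 - omax) / 5 | d23 => (omax + 7) / 25
  | d234 => (omax + 7) / 25 | d34 => (omax + 8) / 37

/-- The right end of the gap between the smallest digit and the others. -/
def gapHi : DigitRange → ℝ
  | d123 => (omax + 2) / 5 | d1234 => (omax + 2) / 5 | d23 => (omax + 1) / 5
  | d234 => (omax + 1) / 5 | d34 => omax / 3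

/-- The values of the sequences of `Dset` whose first digit is in the range. -/
def vals (T : DigitRange) : Set ℝ :=
  {x | ∃ θ ∈ Dset, T.dmin ≤ θ 0 ∧ θ 0 ≤ T.dmax ∧ x = cfVal θ}

lemma one_div_mem_vals {T T' : DigitRange} {d : ℕ} (hd : 1 ≤ d ∧ d ≤ 4)
    (hT : T.dmin ≤ d ∧ d ≤ T.dmax) (hbad : d ≤ 2 → T'.dmax ≤ 3) {x : ℝ} (hx : x ∈ T'.vals) :
    1 / (d + x) ∈ T.vals := by
  obtain ⟨θ, hθ, h1, h2, rfl⟩ := hx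
  refine ⟨app [d] θ, cons_mem_Dset hθ hd ?_, ?_, ?_, (cfVal_cons hθ hd).symm⟩
  · simp only [badPairs, mem_insert_iff, mem_singleton_iff, Prod.mk.injEq]
    omega
  · simpa only [app_cons_zero] using hT.1
  · simpa only [app_cons_zero] using hT.2

lemma vals_mono {T T' : DigitRange} (h1 : T.dmin ≤ T'.dmin) (h2 : T'.dmax ≤ T.dmax) :
    T'.vals ⊆ T.vals :=
  fun _ ⟨θ, hθ, h3, h4, h⟩ => ⟨θ, hθ, h1.trans h3, h4.trans h2, h⟩

lemma bounds (T : DigitRange) :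
    0 ≤ T.lo ∧ T.lo < T.gapLo ∧ T.gapLo < T.gapHi ∧ T.gapHi < T.hi := by
  have h1 := omax_gt
  have h2 := omax_lt
  cases T <;> simp only [lo, hi, gapLo, gapHi] <;>
    refine ⟨?_, ?_, ?_, ?_⟩ <;> linarith

lemma exists_mem_vals (T : DigitRange) : ∃ x ∈ T.vals, x ∈ Icc T.lo T.hi := by
  have h1 := omax_gt
  have h2 := omax_lt
  have h13 : ∀ T : DigitRange, T.dmin ≤ 1 → 1 ≤ T.dmax → omax ∈ T.vals :=
    fun T h h' => ⟨per13, per13_mem_Dset, h, h', rfl⟩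
  have h31 : ∀ T : DigitRange, T.dmin ≤ 3 → 3 ≤ T.dmax → omax / 3 ∈ T.vals :=
    fun T h h' => ⟨per31, per31_mem_Dset, h, h', cfVal_per31.symm⟩
  cases T
  · exact ⟨omax, h13 _ (by decide) (by decide), by simp only [lo, hi]; constructor <;> linarith⟩
  · exact ⟨omax, h13 _ (by decide) (by decide), by simp only [lo, hi]; constructor <;> linarith⟩
  all_goals
    exact ⟨omax / 3, h31 _ (by decide) (by decide), by simp only [lo, hi]; constructor <;> linarith⟩

end DigitRange

/-- A node of the interval tree: a branch together with a range for the next digit. -/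
abbrev Node := Mob × DigitRange

namespace Node

open DigitRange

/-- The left end of the interval of a node. -/
def L (n : Node) : ℝ := min (n.1.ev n.2.lo) (n.1.ev n.2.hi)

/-- The right end of the interval of a node. -/
def R (n : Node) : ℝ := max (n.1.ev n.2.lo) (n.1.ev n.2.hi)

/-- The length of the gap of a node. -/
def gap (n : Node) : ℝ := n.1.len n.2.gapLo n.2.gapHi

/-- The Cantor set of a node. -/
def X (n : Node) : Set ℝ := n.1.ev '' n.2.vals

lemma R_sub_L (n : Node) : n.R - n.L = n.1.len n.2.lo n.2.hi :=
  n.1.max_sub_min_ev n.2.bounds.1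
    (n.2.bounds.2.1.trans (n.2.bounds.2.2.1.trans n.2.bounds.2.2.2))

lemma gap_pos (n : Node) : 0 < n.gap :=
  n.1.len_pos (n.2.bounds.1.trans n.2.bounds.2.1.le) n.2.bounds.2.2.1

lemma exists_mem_X (n : Node) : ∃ x ∈ n.X, x ∈ Icc n.L n.R := by
  obtain ⟨x, hx, hx'⟩ := n.2.exists_mem_vals
  exact ⟨n.1.ev x, mem_image_of_mem _ hx, n.1.ev_mem_Icc n.2.bounds.1 hx'⟩

/-- `m` is a subnode of `(f, T)` whose interval is the image under `f` of `[x, y]`. -/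
structure IsPart (f : Mob) (T : DigitRange) (x y : ℝ) (m : Node) : Prop where
  L_eq : m.L = min (f.ev x) (f.ev y)
  R_eq : m.R = max (f.ev x) (f.ev y)
  X_subset : m.X ⊆ X (f, T)

lemma isPart_same (f : Mob) {T T' : DigitRange} (h1 : T.dmin ≤ T'.dmin) (h2 : T'.dmax ≤ T.dmax) :
    IsPart f T T'.lo T'.hi (f, T') :=
  ⟨rfl, rfl, image_mono (vals_mono h1 h2)⟩

lemma X_push_subset (f : Mob) {T T' : DigitRange} {d : ℕ} (hd : 1 ≤ d ∧ d ≤ 4)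
    (hT : T.dmin ≤ d ∧ d ≤ T.dmax) (hbad : d ≤ 2 → T'.dmax ≤ 3) :
    X (f.push d hd.1, T') ⊆ X (f, T) := by
  rintro _ ⟨z, hz, rfl⟩
  refine ⟨1 / (d + z), one_div_mem_vals hd hT hbad hz, ?_⟩
  obtain ⟨θ, hθ, -, -, rfl⟩ := hz
  have hz0 := one_fifth_le_cfVal (isDigitSeq_of_mem_Dset hθ)
  exact (f.ev_push_eq hd.1 (by linarith)).symm

lemma isPart_push (f : Mob) {T T' : DigitRange} {d : ℕ} (hd : 1 ≤ d ∧ d ≤ 4)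
    (hT : T.dmin ≤ d ∧ d ≤ T.dmax) (hbad : d ≤ 2 → T'.dmax ≤ 3) {x y : ℝ}
    (hx : (d + T'.hi) * x = 1) (hy : (d + T'.lo) * y = 1) :
    IsPart f T x y (f.push d hd.1, T') := by
  obtain ⟨h0, h1, h2, h3⟩ := T'.bounds
  have hlo := f.ev_push hd.1 h0 hy
  have hhi := f.ev_push hd.1 (by linarith) hx
  refine ⟨?_, ?_, X_push_subset f hd hT hbad⟩
  · simp only [L, hlo, hhi]
    exact min_comm _ _
  · simp only [R, hlo, hhi]
    exact max_comm _ _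

lemma isHallSplit_of_isPart {f : Mob} {T : DigitRange} {m m' : Node}
    (h : IsPart f T T.lo T.gapLo m) (h' : IsPart f T T.gapHi T.hi m')
    (hg : gap (f, T) ≤ f.len T.lo T.gapLo) (hg' : gap (f, T) ≤ f.len T.gapHi T.hi)
    (hm : m.gap ≤ gap (f, T)) (hm' : m'.gap ≤ gap (f, T)) :
    ∃ a b, IsHallSplit L R gap X (f, T) a b := by
  obtain ⟨h0, h1, h2, h3⟩ := T.bounds
  have e0 : m.R - m.L = f.len T.lo T.gapLo := by
    rw [h.L_eq, h.R_eq, f.max_sub_min_ev h0 h1]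
  have e1 : m'.R - m'.L = f.len T.gapHi T.hi := by
    rw [h'.L_eq, h'.R_eq, f.max_sub_min_ev (by linarith) h3]
  have s1 := f.ev_sub_ev h0 (by linarith : 0 ≤ T.gapLo)
  have s2 := f.ev_sub_ev (by linarith : 0 ≤ T.gapLo) (by linarith : 0 ≤ T.gapHi)
  have s3 := f.ev_sub_ev (by linarith : 0 ≤ T.gapHi) (by linarith : 0 ≤ T.hi)
  have p1 := f.len_pos h0 h1
  have p2 := f.len_pos (by linarith) h2
  have p3 := f.len_pos (by linarith) h3
  have hgap : gap (f, T) = f.len T.gapLo T.gapHi := rfl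
  have hL : L (f, T) = min (f.ev T.lo) (f.ev T.hi) := rfl
  have hR : R (f, T) = max (f.ev T.lo) (f.ev T.hi) := rfl
  have l := h.L_eq
  have r := h.R_eq
  have l' := h'.L_eq
  have r' := h'.R_eq
  rcases f.det with hdet | hdet <;> rw [hdet] at s1 s2 s3
  · rw [min_eq_left (by linarith)] at l l' hL
    rw [max_eq_right (by linarith)] at r r' hR
    exact ⟨m, m', by linarith, by linarith, by linarith, h.X_subset, h'.X_subset,
      by linarith, by linarith, hm, hm'⟩
  · rw [min_eq_right (by linarith)] at l l' hL
    rw [max_eq_left (by linarith)] at r r' hR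
    exact ⟨m', m, by linarith, by linarith, by linarith, h'.X_subset, h.X_subset,
      by linarith, by linarith, hm', hm⟩

lemma gap_push_one (f : Mob) :
    gap (f.push 1, d123) = f.len ((4 - omax) / 5) ((omax + 11) / 17) := by
  have := omax_gt
  have := omax_lt
  refine f.len_push (by norm_num) ?_ ?_ ?_ ?_ <;> simp only [gapLo, gapHi] <;> push_cast <;>
    linarith [omax_sq]

lemma gap_push_two (f : Mob) :
    gap (f.push 2, d123) = f.len ((9 - omax) / 21) ((omax + 16) / 41) := by
  have := omax_gt
  have := omax_lt
  refine f.len_push (by norm_num) ?_ ?_ ?_ ?_ <;> simp only [gapLo, gapHi] <;> push_cast <;>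
    linarith [omax_sq]

lemma gap_push_three (f : Mob) :
    gap (f.push 3, d1234) = f.len ((14 - omax) / 47) ((omax + 21) / 75) := by
  have := omax_gt
  have := omax_lt
  refine f.len_push (by norm_num) ?_ ?_ ?_ ?_ <;> simp only [gapLo, gapHi] <;> push_cast <;>
    linarith [omax_sq]

lemma gap_push_four (f : Mob) :
    gap (f.push 4, d1234) = f.len ((19 - omax) / 83) ((omax + 26) / 119) := by
  have := omax_gt
  have := omax_lt
  refine f.len_push (by norm_num) ?_ ?_ ?_ ?_ <;> simp only [gapLo, gapHi] <;> push_cast <;>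
    linarith [omax_sq]

lemma gap_le_len_lo (n : Node) : n.gap ≤ n.1.len n.2.lo n.2.gapLo := by
  obtain ⟨f, T⟩ := n
  have h1 := omax_gt
  have h2 := omax_lt
  have h3 := omax_sq
  have h4 := omax_cube
  unfold gap
  cases T <;> simp only [lo, gapLo, gapHi] <;> apply f.len_le_len <;> nlinarith

lemma gap_le_len_hi (n : Node) : n.gap ≤ n.1.len n.2.gapHi n.2.hi := by
  obtain ⟨f, T⟩ := n
  have h1 := omax_gt
  have h2 := omax_lt
  have h3 := omax_sq
  have h4 := omax_cube
  unfold gap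
  cases T <;> simp only [hi, gapLo, gapHi] <;> apply f.len_le_len <;> nlinarith

lemma R_sub_L_le (n : Node) : n.R - n.L ≤ 10 * n.gap := by
  rw [R_sub_L]
  obtain ⟨f, T⟩ := n
  have h1 := omax_gt
  have h2 := omax_lt
  have h3 := omax_sq
  have h4 := omax_cube
  unfold gap
  cases T <;> simp only [hi, lo, gapLo, gapHi] <;> apply f.len_le_mul_len <;> nlinarith

lemma exists_isHallSplit (n : Node) : ∃ a b, IsHallSplit L R gap X n a b := by
  obtain ⟨f, T⟩ := n
  have h1 := omax_gt
  have h2 := omax_lt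
  have h3 := omax_sq
  have h4 := omax_cube
  have hlo := gap_le_len_lo (f, T)
  have hhi := gap_le_len_hi (f, T)
  cases T
  · refine isHallSplit_of_isPart (T := d123) (m := (f, d23)) (m' := (f.push 1, d123))
      (isPart_same f (T := d123) (T' := d23) (by decide) (by decide))
      (isPart_push f (by decide) (by decide) (by decide) ?_ ?_) hlo hhi ?_
      ((gap_push_one f).trans_le ?_)
    all_goals simp only [gap, lo, hi, gapLo, gapHi]
    · push_cast; linarith
    · push_cast; linarith
    all_goals apply f.len_le_len <;> nlinarith
  · refine isHallSplit_of_isPart (T := d1234) (m := (f, d234)) (m' := (f.push 1, d123))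
      (isPart_same f (T := d1234) (T' := d234) (by decide) (by decide))
      (isPart_push f (by decide) (by decide) (by decide) ?_ ?_) hlo hhi ?_
      ((gap_push_one f).trans_le ?_)
    all_goals simp only [gap, lo, hi, gapLo, gapHi]
    · push_cast; linarith
    · push_cast; linarith
    all_goals apply f.len_le_len <;> nlinarith
  · refine isHallSplit_of_isPart (T := d23) (m := (f.push 3, d1234)) (m' := (f.push 2, d123))
      (isPart_push f (by decide) (by decide) (by decide) ?_ ?_)
      (isPart_push f (by decide) (by decide) (by decide) ?_ ?_) hlo hhi
      ((gap_push_three f).trans_le ?_) ((gap_push_two f).trans_le ?_)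
    all_goals simp only [gap, lo, hi, gapLo, gapHi]
    · push_cast; linarith
    · push_cast; linarith
    · push_cast; linarith
    · push_cast; linarith
    all_goals apply f.len_le_len <;> nlinarith
  · refine isHallSplit_of_isPart (T := d234) (m := (f, d34)) (m' := (f.push 2, d123))
      (isPart_same f (T := d234) (T' := d34) (by decide) (by decide))
      (isPart_push f (by decide) (by decide) (by decide) ?_ ?_) hlo hhi ?_
      ((gap_push_two f).trans_le ?_)
    all_goals simp only [gap, lo, hi, gapLo, gapHi]
    · push_cast; linarith
    · push_cast; linarith
    all_goals apply f.len_le_len <;> nlinarith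
  · refine isHallSplit_of_isPart (T := d34) (m := (f.push 4, d1234)) (m' := (f.push 3, d1234))
      (isPart_push f (by decide) (by decide) (by decide) ?_ ?_)
      (isPart_push f (by decide) (by decide) (by decide) ?_ ?_) hlo hhi
      ((gap_push_four f).trans_le ?_) ((gap_push_three f).trans_le ?_)
    all_goals simp only [gap, lo, hi, gapLo, gapHi]
    · push_cast; linarith
    · push_cast; linarith
    · push_cast; linarith
    · push_cast; linarith
    all_goals apply f.len_le_len <;> nlinarith

theorem Icc_subset_closure {m n : Node} (h : m.gap ≤ n.R - n.L) (h' : n.gap ≤ m.R - m.L) :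
    Icc (m.L + n.L) (m.R + n.R) ⊆ closure (m.X + n.X) :=
  Icc_subset_closure_add exists_mem_X exists_isHallSplit (by norm_num : (1 : ℝ) ≤ 10) gap_pos
    R_sub_L_le h h'

end Node

/-! ### Pieces of the two Cantor sets and their sums -/

namespace Node

/-- In the coordinate of `f`, the interval of `n` is `[x, y]` and its gap has the length of
`(u, v)`. -/
structure HasShape (f : Mob) (n : Node) (x u v y : ℝ) : Prop where
  x_nonneg : 0 ≤ x
  x_lt_u : x < u
  u_lt_v : u < v
  v_lt_y : v < y
  L_eq : n.L = min (f.ev x) (f.ev y)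
  R_eq : n.R = max (f.ev x) (f.ev y)
  gap_eq : n.gap = f.len u v

lemma hasShape (f : Mob) (T : DigitRange) :
    HasShape f (f, T) T.lo T.gapLo T.gapHi T.hi :=
  ⟨T.bounds.1, T.bounds.2.1, T.bounds.2.2.1, T.bounds.2.2.2, rfl, rfl, rfl⟩

lemma HasShape.of_push {f : Mob} {n : Node} {d : ℕ} {hd : 1 ≤ d} {x u v y x' u' v' y' : ℝ}
    (h : HasShape (f.push d hd) n x u v y) (hx : (d + x) * y' = 1) (hu : (d + u) * v' = 1)
    (hv : (d + v) * u' = 1) (hy : (d + y) * x' = 1) : HasShape f n x' u' v' y' := by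
  have h0 := h.x_nonneg
  have h1 := h.x_lt_u
  have h2 := h.u_lt_v
  have h3 := h.v_lt_y
  have hd1 : (1 : ℝ) ≤ d := by exact_mod_cast hd
  have hlt : ∀ {s t s' t' : ℝ}, 0 ≤ s → s < t → (d + s) * t' = 1 → (d + t) * s' = 1 → s' < t' := by
    intro s t s' t' hs hst e1 e2
    rw [mul_comm, ← eq_div_iff (by linarith)] at e1 e2
    rw [e1, e2]
    exact one_div_lt_one_div_of_lt (by linarith) (by linarith)
  refine ⟨?_, hlt (by linarith) h3 hv hy, hlt (by linarith) h2 hu hv, hlt h0 h1 hx hu, ?_, ?_, ?_⟩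
  · by_contra hcon
    nlinarith
  · rw [h.L_eq, f.ev_push hd h0 hx, f.ev_push hd (by linarith) hy, min_comm]
  · rw [h.R_eq, f.ev_push hd h0 hx, f.ev_push hd (by linarith) hy, max_comm]
  · rw [h.gap_eq, f.len_push hd (by linarith) (by linarith) hu hv]

end Node

namespace Mob

lemma ev_push_four (f : Mob) {x : ℝ} : (f.push 4).ev x = (f.push 3).ev (1 + x) := by
  simp only [ev, push]
  push_cast
  congr 1 <;> ring

lemma det_push_push (f : Mob) {d e : ℕ} (hd : 1 ≤ d) (he : 1 ≤ e)
    (h : f.p' * f.q - f.p * f.q' = 1) :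
    ((f.push d hd).push e he).p' * ((f.push d hd).push e he).q -
      ((f.push d hd).push e he).p * ((f.push d hd).push e he).q' = 1 := by
  simp only [push]
  linear_combination h

/-- It suffices to compare lengths coefficientwise (after Abel summation) in the `q, q'` of the
map `f`. -/
lemma len_push_le_len_push (f : Mob) {x y x' y' : ℝ} (hx : 0 ≤ x) (hy : 0 ≤ y) (hx' : 0 ≤ x')
    (hy' : 0 ≤ y') (h0 : (y - x) * ((4 + x') * (4 + y')) ≤ (y' - x') * ((4 + x) * (4 + y)))
    (h1 : (y - x) * (3 * ((4 + x') * (4 + y')) - (8 + x' + y')) ≤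
      (y' - x') * (3 * ((4 + x) * (4 + y)) - (8 + x + y)))
    (h2 : (y - x) * ((7 + 2 * x') * (7 + 2 * y')) ≤ (y' - x') * ((7 + 2 * x) * (7 + 2 * y))) :
    ((f.push 1).push 3).len x y ≤ ((f.push 1).push 3).len x' y' := by
  have hq := f.q_pos
  have hq' := f.q'_nonneg
  have hle := f.q'_le
  set g := (f.push 1).push 3 with hg
  have e1 : g.q = 4 * f.q + 3 * f.q' := by
    simp only [hg, push]
    push_cast
    ring
  have e2 : g.q' = f.q + f.q' := by
    simp only [hg, push]
    push_cast
    ring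
  rw [len, len, div_le_div_iff₀ (mul_pos (g.denom_pos hx) (g.denom_pos hy))
    (mul_pos (g.denom_pos hx') (g.denom_pos hy')), e1, e2]
  linear_combination f.q * (f.q - f.q') * h0 + f.q' * (f.q - f.q') * h1 + f.q' ^ 2 * h2

end Mob

/-- The sequences of `Dset` that do not start with `1, 3`. -/
def Dtil : Set (ℕ → ℕ) := {θ ∈ Dset | (θ 0, θ 1) ≠ (1, 3)}

lemma Icc_subset_of_le {a b c d : ℝ} {S : Set ℝ} (h₁ : Icc a b ⊆ S) (h₂ : Icc c d ⊆ S)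
    (h : c ≤ b) : Icc a d ⊆ S := by
  intro z hz
  rcases le_total z b with hzb | hzb
  · exact h₁ ⟨hz.1, hzb⟩
  · exact h₂ ⟨h.trans hzb, hz.2⟩

namespace Node

open DigitRange

lemma X_subset_Dtil (f : Mob) : X (f, d234) ⊆ f.ev '' (cfVal '' Dtil) := by
  rintro _ ⟨_, ⟨θ, hθ, h1, -, rfl⟩, rfl⟩
  refine mem_image_of_mem _ (mem_image_of_mem _ ⟨hθ, ?_⟩)
  simp only [dmin] at h1
  simp only [ne_eq, Prod.mk.injEq]
  omega

lemma X_push_push_subset_Dtil (f : Mob) {d : ℕ} (hd : 1 ≤ d) (hd2 : d ≤ 2) :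
    X ((f.push 1).push d hd, d123) ⊆ f.ev '' (cfVal '' Dtil) := by
  rintro _ ⟨_, ⟨θ, hθ, -, h1, rfl⟩, rfl⟩
  have h0 := one_fifth_le_cfVal (isDigitSeq_of_mem_Dset hθ)
  have hd0 : (0 : ℝ) < d := by exact_mod_cast hd
  simp only [dmax] at h1
  have hθ' : app [d] θ ∈ Dset := by
    refine cons_mem_Dset hθ ⟨hd, by omega⟩ ?_
    simp only [badPairs, mem_insert_iff, mem_singleton_iff, Prod.mk.injEq]
    omega
  have hθ'' : app [1] (app [d] θ) ∈ Dset := by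
    refine cons_mem_Dset hθ' (by norm_num) ?_
    simp only [badPairs, mem_insert_iff, mem_singleton_iff, Prod.mk.injEq, app_cons_zero]
    omega
  refine ⟨_, ⟨_, ⟨hθ'', ?_⟩, rfl⟩, ?_⟩
  · simp only [ne_eq, Prod.mk.injEq, app_cons_zero, app_cons_succ, app_nil]
    omega
  · rw [(f.push 1).ev_push_eq hd (by linarith), f.ev_push_eq _ (by positivity),
      cfVal_cons hθ' (by norm_num), cfVal_cons hθ ⟨hd, by omega⟩]

/-- The interval `[x, y]` of the coordinate of `g` is mapped increasingly onto that of `n`. -/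
structure IsPlaced (g : Mob) (S : Set ℝ) (n : Node) (x u v y : ℝ) : Prop where
  L_eq : n.L = g.ev x
  R_eq : n.R = g.ev y
  gap_eq : n.gap = g.ev v - g.ev u
  X_subset : n.X ⊆ S

lemma HasShape.isPlaced {g : Mob} {n : Node} {x u v y : ℝ} (h : HasShape g n x u v y)
    (hdet : g.p' * g.q - g.p * g.q' = 1) {S : Set ℝ} (hS : n.X ⊆ S) :
    IsPlaced g S n x u v y := by
  have h0 := h.x_nonneg
  have h1 := h.x_lt_u
  have h2 := h.u_lt_v
  have h3 := h.v_lt_y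
  have hxy := g.ev_sub_ev h0 (by linarith : 0 ≤ y)
  have huv := g.ev_sub_ev (by linarith : 0 ≤ u) (by linarith : 0 ≤ v)
  have hpos := g.len_pos h0 (by linarith : x < y)
  rw [hdet, one_mul] at hxy huv
  refine ⟨?_, ?_, ?_, hS⟩
  · rw [h.L_eq, min_eq_left (by linarith)]
  · rw [h.R_eq, max_eq_right (by linarith)]
  · rw [h.gap_eq, huv]

lemma IsPlaced.shift {f : Mob} {S : Set ℝ} {n : Node} {x u v y : ℝ}
    (h : IsPlaced (f.push 4) S n x u v y) :
    IsPlaced (f.push 3) S n (1 + x) (1 + u) (1 + v) (1 + y) := by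
  refine ⟨?_, ?_, ?_, h.X_subset⟩
  · rw [h.L_eq, f.ev_push_four]
  · rw [h.R_eq, f.ev_push_four]
  · rw [h.gap_eq, f.ev_push_four, f.ev_push_four]

lemma IsPlaced.Icc_subset {g : Mob} {S S' : Set ℝ} {n n' : Node} {x u v y x' u' v' y' : ℝ}
    (h : IsPlaced g S n x u v y) (h' : IsPlaced g S' n' x' u' v' y')
    (h1 : g.ev v - g.ev u ≤ g.ev y' - g.ev x') (h2 : g.ev v' - g.ev u' ≤ g.ev y - g.ev x) :
    Icc (g.ev x + g.ev x') (g.ev y + g.ev y') ⊆ closure (S + S') := by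
  rw [← h.L_eq, ← h.R_eq, ← h.gap_eq] at *
  rw [← h'.L_eq, ← h'.R_eq, ← h'.gap_eq] at *
  exact (Icc_subset_closure h1 h2).trans
    (closure_mono (add_subset_add h.X_subset h'.X_subset))

end Node

namespace Mob

/-- Comparison of differences of values of `x ↦ f [0; 1, 3 + x]`, see `len_push_le_len_push`. -/
lemma ev_sub_ev_le {f : Mob} (hdet : f.p' * f.q - f.p * f.q' = 1) {x y x' y' : ℝ} (hx : 0 ≤ x)
    (hy : 0 ≤ y) (hx' : 0 ≤ x') (hy' : 0 ≤ y')
    (h0 : (y - x) * ((4 + x') * (4 + y')) ≤ (y' - x') * ((4 + x) * (4 + y)))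
    (h1 : (y - x) * (3 * ((4 + x') * (4 + y')) - (8 + x' + y')) ≤
      (y' - x') * (3 * ((4 + x) * (4 + y)) - (8 + x + y)))
    (h2 : (y - x) * ((7 + 2 * x') * (7 + 2 * y')) ≤ (y' - x') * ((7 + 2 * x) * (7 + 2 * y))) :
    ((f.push 1).push 3).ev y - ((f.push 1).push 3).ev x ≤
      ((f.push 1).push 3).ev y' - ((f.push 1).push 3).ev x' := by
  rw [ev_sub_ev _ hx hy, ev_sub_ev _ hx' hy', f.det_push_push (by norm_num) (by norm_num) hdet,
    one_mul, one_mul]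
  exact f.len_push_le_len_push hx hy hx' hy' h0 h1 h2

end Mob

namespace Node

open DigitRange

lemma isPlaced_four_d234 {f : Mob} (hdet : f.p' * f.q - f.p * f.q' = 1) :
    IsPlaced ((f.push 1).push 3) (((f.push 1).push 4).ev '' (cfVal '' Dtil))
      ((f.push 1).push 4, d234) (1 + (1 - omax)) (1 + (omax + 7) / 25) (1 + (omax + 1) / 5)
      (1 + (3 - omax) / 5) := by
  have hdetI := f.det_push_push (d := 1) (e := 4) (by norm_num) (by norm_num) hdet
  exact ((hasShape _ d234).isPlaced hdetI (X_subset_Dtil _)).shift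

lemma isPlaced_four_one_one {f : Mob} (hdet : f.p' * f.q - f.p * f.q' = 1) :
    IsPlaced ((f.push 1).push 3) (((f.push 1).push 4).ev '' (cfVal '' Dtil))
      ((((f.push 1).push 4).push 1).push 1, d123) (1 + (omax + 2) / 5) (1 + (25 - omax) / 41)
      (1 + (omax + 12) / 21) (1 + (4 - omax) / 5) := by
  have b1 := omax_gt
  have b2 := omax_lt
  have b3 := omax_sq
  have hdetI := f.det_push_push (d := 1) (e := 4) (by norm_num) (by norm_num) hdet
  refine ((((hasShape ((((f.push 1).push 4).push 1).push 1) d123).of_push (x' := (omax + 2) / 5)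
    (u' := (4 - omax) / 5) (v' := (omax + 11) / 17) (y' := omax) ?_ ?_ ?_ ?_).of_push
    ?_ ?_ ?_ ?_).isPlaced hdetI (X_push_push_subset_Dtil _ _ (by norm_num))).shift
  all_goals (try simp only [lo, hi, gapLo, gapHi]); push_cast; linarith

lemma isPlaced_four_one_two {f : Mob} (hdet : f.p' * f.q - f.p * f.q' = 1) :
    IsPlaced ((f.push 1).push 3) (((f.push 1).push 4).ev '' (cfVal '' Dtil))
      ((((f.push 1).push 4).push 1).push 2, d123) (1 + (omax + 11) / 17) (1 + (54 - omax) / 75)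
      (1 + (omax + 33) / 47) (1 + (1 - omax / 3)) := by
  have b1 := omax_gt
  have b2 := omax_lt
  have b3 := omax_sq
  have hdetI := f.det_push_push (d := 1) (e := 4) (by norm_num) (by norm_num) hdet
  refine ((((hasShape ((((f.push 1).push 4).push 1).push 2) d123).of_push (x' := (omax + 1) / 5)
    (u' := (9 - omax) / 21) (v' := (omax + 16) / 41) (y' := (3 - omax) / 5) ?_ ?_ ?_ ?_).of_push
    ?_ ?_ ?_ ?_).isPlaced hdetI (X_push_push_subset_Dtil _ _ (by norm_num))).shift
  all_goals (try simp only [lo, hi, gapLo, gapHi]); push_cast; linarith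

lemma isPlaced_d234 {g : Mob} (hdet : g.p' * g.q - g.p * g.q' = 1) :
    IsPlaced g (X (g, d1234)) (g, d234) (1 - omax) ((omax + 7) / 25) ((omax + 1) / 5)
      ((3 - omax) / 5) :=
  (hasShape _ d234).isPlaced hdet (isPart_same g (by decide) (by decide)).X_subset

lemma isPlaced_one_d123 {g : Mob} (hdet : g.p' * g.q - g.p * g.q' = 1) :
    IsPlaced g (X (g, d1234)) (g.push 1, d123) ((omax + 2) / 5) ((4 - omax) / 5)
      ((omax + 11) / 17) omax := by
  have b1 := omax_gt
  have b2 := omax_lt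
  have b3 := omax_sq
  refine ((hasShape (g.push 1) d123).of_push ?_ ?_ ?_ ?_).isPlaced hdet
    (X_push_subset g (by decide) (by decide) (by decide))
  all_goals (try simp only [lo, hi, gapLo, gapHi]); push_cast; linarith

lemma isPlaced_four {g : Mob} (hdet : g.p' * g.q - g.p * g.q' = 1) :
    IsPlaced g (X (g, d1234)) (g.push 4, d1234) (1 - omax) ((19 - omax) / 83)
      ((omax + 26) / 119) ((omax + 8) / 37) := by
  have b1 := omax_gt
  have b2 := omax_lt
  have b3 := omax_sq
  refine ((hasShape (g.push 4) d1234).of_push ?_ ?_ ?_ ?_).isPlaced hdet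
    (X_push_subset g (by decide) (by decide) (by decide))
  all_goals (try simp only [lo, hi, gapLo, gapHi]); push_cast; linarith

lemma isPlaced_three {g : Mob} (hdet : g.p' * g.q - g.p * g.q' = 1) :
    IsPlaced g (X (g, d1234)) (g.push 3, d1234) (omax / 3) ((14 - omax) / 47)
      ((omax + 21) / 75) ((omax + 7) / 25) := by
  have b1 := omax_gt
  have b2 := omax_lt
  have b3 := omax_sq
  refine ((hasShape (g.push 3) d1234).of_push ?_ ?_ ?_ ?_).isPlaced hdet
    (X_push_subset g (by decide) (by decide) (by decide))
  all_goals (try simp only [lo, hi, gapLo, gapHi]); push_cast; linarith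

lemma isPlaced_two {g : Mob} (hdet : g.p' * g.q - g.p * g.q' = 1) :
    IsPlaced g (X (g, d1234)) (g.push 2, d123) ((omax + 1) / 5) ((9 - omax) / 21)
      ((omax + 16) / 41) ((3 - omax) / 5) := by
  have b1 := omax_gt
  have b2 := omax_lt
  have b3 := omax_sq
  refine ((hasShape (g.push 2) d123).of_push ?_ ?_ ?_ ?_).isPlaced hdet
    (X_push_subset g (by decide) (by decide) (by decide))
  all_goals (try simp only [lo, hi, gapLo, gapHi]); push_cast; linarith

lemma isPlaced_one_one {g : Mob} (hdet : g.p' * g.q - g.p * g.q' = 1) :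
    IsPlaced g (X (g, d1234)) ((g.push 1).push 1, d123) ((omax + 2) / 5) ((25 - omax) / 41)
      ((omax + 12) / 21) ((4 - omax) / 5) := by
  have b1 := omax_gt
  have b2 := omax_lt
  have b3 := omax_sq
  refine (((hasShape ((g.push 1).push 1) d123).of_push (x' := (omax + 2) / 5)
    (u' := (4 - omax) / 5) (v' := (omax + 11) / 17) (y' := omax) ?_ ?_ ?_ ?_).of_push
    ?_ ?_ ?_ ?_).isPlaced hdet
    ((X_push_subset (T := d123) (g.push 1) (by decide) (by decide) (by decide)).trans
      (X_push_subset g (by decide) (by decide) (by decide)))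
  all_goals (try simp only [lo, hi, gapLo, gapHi]); push_cast; linarith

lemma isPlaced_one_d23 {g : Mob} (hdet : g.p' * g.q - g.p * g.q' = 1) :
    IsPlaced g (X (g, d1234)) (g.push 1, d23) ((omax + 11) / 17) (1 - omax / 3)
      ((29 - omax) / 37) omax := by
  have b1 := omax_gt
  have b2 := omax_lt
  have b3 := omax_sq
  refine ((hasShape (g.push 1) d23).of_push ?_ ?_ ?_ ?_).isPlaced hdet
    (X_push_subset g (by decide) (by decide) (by decide))
  all_goals (try simp only [lo, hi, gapLo, gapHi]); push_cast; linarith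

/-- The two pieces of the first summand behind the digits `4, 1` act as a single interval. -/
lemma Icc_subset_closure_add_isPlaced {f : Mob} (hdet : f.p' * f.q - f.p * f.q' = 1)
    {T : Set ℝ} {n : Node} {x u v y : ℝ} (hn : IsPlaced ((f.push 1).push 3) T n x u v y)
    (h1 : ((f.push 1).push 3).ev (1 + (omax + 11) / 17) -
      ((f.push 1).push 3).ev (1 + (4 - omax) / 5) ≤
        ((f.push 1).push 3).ev y - ((f.push 1).push 3).ev x)
    (h2 : ((f.push 1).push 3).ev v - ((f.push 1).push 3).ev u ≤
      ((f.push 1).push 3).ev (1 + (1 - omax / 3)) -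
        ((f.push 1).push 3).ev (1 + (omax + 11) / 17)) :
    Icc (((f.push 1).push 3).ev (1 + (omax + 2) / 5) + ((f.push 1).push 3).ev x)
        (((f.push 1).push 3).ev (1 + (1 - omax / 3)) + ((f.push 1).push 3).ev y) ⊆
      closure (((f.push 1).push 4).ev '' (cfVal '' Dtil) + T) := by
  have b1 := omax_gt
  have b2 := omax_lt
  have b3 := omax_sq
  have b4 := omax_cube
  set g := (f.push 1).push 3 with hg
  have m1 : g.ev (1 + (1 - omax / 3)) - g.ev (1 + (omax + 11) / 17) ≤
      g.ev (1 + (4 - omax) / 5) - g.ev (1 + (omax + 2) / 5) := by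
    apply Mob.ev_sub_ev_le hdet <;> linarith
  have p11 : g.ev (1 + (omax + 12) / 21) - g.ev (1 + (25 - omax) / 41) ≤
      g.ev (1 + (omax + 11) / 17) - g.ev (1 + (4 - omax) / 5) := by
    apply Mob.ev_sub_ev_le hdet <;> linarith
  have p12 : g.ev (1 + (omax + 33) / 47) - g.ev (1 + (54 - omax) / 75) ≤
      g.ev (1 + (omax + 11) / 17) - g.ev (1 + (4 - omax) / 5) := by
    apply Mob.ev_sub_ev_le hdet <;> linarith
  exact Icc_subset_of_le ((isPlaced_four_one_one hdet).Icc_subset hn (p11.trans h1) (h2.trans m1))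
    ((isPlaced_four_one_two hdet).Icc_subset hn (p12.trans h1) h2) (by linarith)

/-- The part of the sum where the second summand has first free digit at least `2`. -/
lemma Icc_subset_closure_low {f : Mob} (hdet : f.p' * f.q - f.p * f.q' = 1) :
    Icc (((f.push 1).push 3).ev (1 + (1 - omax)) + ((f.push 1).push 3).ev (1 - omax))
        (((f.push 1).push 3).ev (1 + (1 - omax / 3)) + ((f.push 1).push 3).ev ((3 - omax) / 5)) ⊆
      closure (((f.push 1).push 4).ev '' (cfVal '' Dtil) +
        X ((f.push 1).push 3, d1234)) := by
  have b1 := omax_gt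
  have b2 := omax_lt
  have b3 := omax_sq
  have b4 := omax_cube
  set g := (f.push 1).push 3 with hg
  have hdetJ : g.p' * g.q - g.p * g.q' = 1 :=
    f.det_push_push (d := 1) (e := 3) (by norm_num) (by norm_num) hdet
  have c1 : g.ev ((omax + 1) / 5) - g.ev ((omax + 7) / 25) ≤
      g.ev (1 + (3 - omax) / 5) - g.ev (1 + (1 - omax)) := by
    apply Mob.ev_sub_ev_le hdet <;> linarith
  have c3 : g.ev (1 + (omax + 1) / 5) - g.ev (1 + (omax + 7) / 25) ≤
      g.ev ((3 - omax) / 5) - g.ev (1 - omax) := by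
    apply Mob.ev_sub_ev_le hdet <;> linarith
  have c5 : g.ev (1 + (omax + 2) / 5) - g.ev (1 + (3 - omax) / 5) ≤
      g.ev ((3 - omax) / 5) - g.ev (1 - omax) := by
    apply Mob.ev_sub_ev_le hdet <;> linarith
  have g1 : g.ev (omax / 3) - g.ev ((omax + 8) / 37) ≤
      g.ev (1 + (1 - omax / 3)) - g.ev (1 + (omax + 2) / 5) := by
    apply Mob.ev_sub_ev_le hdet <;> linarith
  have g2 : g.ev ((omax + 1) / 5) - g.ev ((omax + 7) / 25) ≤
      g.ev (1 + (1 - omax / 3)) - g.ev (1 + (omax + 2) / 5) := by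
    apply Mob.ev_sub_ev_le hdet <;> linarith
  have l4 : g.ev (1 + (omax + 11) / 17) - g.ev (1 + (4 - omax) / 5) ≤
      g.ev ((omax + 8) / 37) - g.ev (1 - omax) := by
    apply Mob.ev_sub_ev_le hdet <;> linarith
  have q4 : g.ev ((omax + 26) / 119) - g.ev ((19 - omax) / 83) ≤
      g.ev (1 + (1 - omax / 3)) - g.ev (1 + (omax + 11) / 17) := by
    apply Mob.ev_sub_ev_le hdet <;> linarith
  have l3 : g.ev (1 + (omax + 11) / 17) - g.ev (1 + (4 - omax) / 5) ≤
      g.ev ((omax + 7) / 25) - g.ev (omax / 3) := by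
    apply Mob.ev_sub_ev_le hdet <;> linarith
  have q3 : g.ev ((omax + 21) / 75) - g.ev ((14 - omax) / 47) ≤
      g.ev (1 + (1 - omax / 3)) - g.ev (1 + (omax + 11) / 17) := by
    apply Mob.ev_sub_ev_le hdet <;> linarith
  have l2 : g.ev (1 + (omax + 11) / 17) - g.ev (1 + (4 - omax) / 5) ≤
      g.ev ((3 - omax) / 5) - g.ev ((omax + 1) / 5) := by
    apply Mob.ev_sub_ev_le hdet <;> linarith
  have q2 : g.ev ((omax + 16) / 41) - g.ev ((9 - omax) / 21) ≤
      g.ev (1 + (1 - omax / 3)) - g.ev (1 + (omax + 11) / 17) := by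
    apply Mob.ev_sub_ev_le hdet <;> linarith
  exact Icc_subset_of_le ((isPlaced_four_d234 hdet).Icc_subset (isPlaced_d234 hdetJ) c3 c1)
    (Icc_subset_of_le (Icc_subset_of_le
      (Icc_subset_closure_add_isPlaced hdet (isPlaced_four hdetJ) l4 q4)
      (Icc_subset_closure_add_isPlaced hdet (isPlaced_three hdetJ) l3 q3) (by linarith))
      (Icc_subset_closure_add_isPlaced hdet (isPlaced_two hdetJ) l2 q2) (by linarith)) (by linarith)

/-- The part of the sum where the second summand has first free digit `1`. -/
lemma Icc_subset_closure_high {f : Mob} (hdet : f.p' * f.q - f.p * f.q' = 1) :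
    Icc (((f.push 1).push 3).ev (1 + (1 - omax)) + ((f.push 1).push 3).ev ((omax + 2) / 5))
        (((f.push 1).push 3).ev (1 + (1 - omax / 3)) + ((f.push 1).push 3).ev omax) ⊆
      closure (((f.push 1).push 4).ev '' (cfVal '' Dtil) +
        X ((f.push 1).push 3, d1234)) := by
  have b1 := omax_gt
  have b2 := omax_lt
  have b3 := omax_sq
  have b4 := omax_cube
  set g := (f.push 1).push 3 with hg
  have hdetJ : g.p' * g.q - g.p * g.q' = 1 :=
    f.det_push_push (d := 1) (e := 3) (by norm_num) (by norm_num) hdet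
  have c2 : g.ev ((omax + 11) / 17) - g.ev ((4 - omax) / 5) ≤
      g.ev (1 + (3 - omax) / 5) - g.ev (1 + (1 - omax)) := by
    apply Mob.ev_sub_ev_le hdet <;> linarith
  have c4 : g.ev (1 + (omax + 1) / 5) - g.ev (1 + (omax + 7) / 25) ≤
      g.ev omax - g.ev ((omax + 2) / 5) := by
    apply Mob.ev_sub_ev_le hdet <;> linarith
  have c6 : g.ev (1 + (omax + 2) / 5) - g.ev (1 + (3 - omax) / 5) ≤
      g.ev omax - g.ev ((omax + 2) / 5) := by
    apply Mob.ev_sub_ev_le hdet <;> linarith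
  have g3 : g.ev ((omax + 11) / 17) - g.ev ((4 - omax) / 5) ≤
      g.ev (1 + (1 - omax / 3)) - g.ev (1 + (omax + 2) / 5) := by
    apply Mob.ev_sub_ev_le hdet <;> linarith
  have l11 : g.ev (1 + (omax + 11) / 17) - g.ev (1 + (4 - omax) / 5) ≤
      g.ev ((4 - omax) / 5) - g.ev ((omax + 2) / 5) := by
    apply Mob.ev_sub_ev_le hdet <;> linarith
  have q11 : g.ev ((omax + 12) / 21) - g.ev ((25 - omax) / 41) ≤
      g.ev (1 + (1 - omax / 3)) - g.ev (1 + (omax + 11) / 17) := by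
    apply Mob.ev_sub_ev_le hdet <;> linarith
  have l123 : g.ev (1 + (omax + 11) / 17) - g.ev (1 + (4 - omax) / 5) ≤
      g.ev omax - g.ev ((omax + 11) / 17) := by
    apply Mob.ev_sub_ev_le hdet <;> linarith
  have q123 : g.ev ((29 - omax) / 37) - g.ev (1 - omax / 3) ≤
      g.ev (1 + (1 - omax / 3)) - g.ev (1 + (omax + 11) / 17) := by
    apply Mob.ev_sub_ev_le hdet <;> linarith
  exact Icc_subset_of_le ((isPlaced_four_d234 hdet).Icc_subset (isPlaced_one_d123 hdetJ) c4 c2)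
    (Icc_subset_of_le (Icc_subset_closure_add_isPlaced hdet (isPlaced_one_one hdetJ) l11 q11)
      (Icc_subset_closure_add_isPlaced hdet (isPlaced_one_d23 hdetJ) l123 q123) (by linarith))
    (by linarith)

end Node

open DigitRange Node in
theorem Icc_subset_closure_image_add (f : Mob) (hdet : f.p' * f.q - f.p * f.q' = 1) :
    Icc (((f.push 1).push 4).ev (1 - omax) + ((f.push 1).push 3).ev (1 - omax))
      (((f.push 1).push 4).ev (1 - omax / 3) + ((f.push 1).push 3).ev omax) ⊆
    closure (((f.push 1).push 4).ev '' (cfVal '' Dtil) +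
      ((f.push 1).push 3).ev '' d1234.vals) := by
  have b1 := omax_gt
  have b2 := omax_lt
  have b3 := omax_sq
  have b4 := omax_cube
  set g := (f.push 1).push 3 with hg
  have c7 : g.ev ((omax + 2) / 5) - g.ev ((3 - omax) / 5) ≤
      g.ev (1 + (1 - omax / 3)) - g.ev (1 + (1 - omax)) := by
    apply Mob.ev_sub_ev_le hdet <;> linarith
  rw [Mob.ev_push_four, Mob.ev_push_four]
  exact Icc_subset_of_le (Icc_subset_closure_low hdet) (Icc_subset_closure_high hdet)
    (by linarith)
/-! ### The sets `Ktil (bW s)` and `Kb (cW s)` -/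

lemma cfBranch_append_pair (f : Mob) {w : List ℕ} (hf : ∀ x, 0 ≤ x → cfBranch w x = f.ev x)
    {d e : ℕ} (hd : 1 ≤ d) (he : 1 ≤ e) {x : ℝ} (hx : 0 ≤ x) :
    cfBranch (w ++ [d, e]) x = ((f.push d hd).push e he).ev x := by
  rw [Mob.ev_push_eq _ he hx, Mob.ev_push_eq _ hd (by positivity), cfBranch_append,
    ← hf _ (by positivity)]
  rfl

lemma exists_mob_bW (n : ℕ) : ∃ f : Mob, f.p' * f.q - f.p * f.q' = 1 ∧
    ∀ x, 0 ≤ x → cfBranch (bW n) x = f.ev x := by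
  induction n with
  | zero =>
    refine ⟨⟨0, 1, 1, 0, by norm_num, by norm_num, by norm_num, by norm_num⟩, by norm_num, ?_⟩
    intro x _
    simp [cfBranch, bW, Mob.ev]
  | succ n ih =>
    obtain ⟨f, hdet, hf⟩ := ih
    refine ⟨(f.push 1).push 4, f.det_push_push (by norm_num) (by norm_num) hdet, fun x hx => ?_⟩
    rw [bW_succ, cfBranch_append_pair f hf (by norm_num) (by norm_num) hx]

lemma Mob.monotoneOn_ev {f : Mob} (hdet : f.p' * f.q - f.p * f.q' = 1) :
    MonotoneOn f.ev (Ici 0) := by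
  intro x hx y hy hxy
  have h := f.ev_sub_ev hx hy
  rw [hdet, one_mul] at h
  rcases hxy.eq_or_lt with rfl | hxy
  · rfl
  · linarith [f.len_pos hx hxy]

lemma Mob.continuousOn_ev (f : Mob) : ContinuousOn f.ev (Ici 0) := by
  unfold Mob.ev
  exact ContinuousOn.div (by fun_prop) (by fun_prop) fun x hx => (f.denom_pos hx).ne'

lemma isCompact_Dtil : IsCompact Dtil := by
  refine isCompact_Dset.inter_right (t := {θ : ℕ → ℕ | (θ 0, θ 1) ≠ (1, 3)}) ?_
  exact (isClosed_discrete ({(1, 3)}ᶜ : Set (ℕ × ℕ))).preimage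
    ((continuous_apply 0).prodMk (continuous_apply 1) :
      Continuous fun θ : ℕ → ℕ => (θ 0, θ 1))

lemma isCompact_image_cfVal {A : Set (ℕ → ℕ)} (hA : IsCompact A) (h : A ⊆ Dset) (f : Mob) :
    IsCompact (f.ev '' (cfVal '' A)) := by
  have hdig : ∀ θ ∈ A, IsDigitSeq θ := fun θ hθ => isDigitSeq_of_mem_Dset (h hθ)
  refine (hA.image_of_continuousOn (continuousOn_cfVal.mono hdig)).image_of_continuousOn
    (f.continuousOn_ev.mono ?_)
  rintro _ ⟨θ, hθ, rfl⟩
  have := one_fifth_le_cfVal (hdig θ hθ)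
  exact (by linarith : (0 : ℝ) ≤ cfVal θ)

lemma vals_d1234 : DigitRange.d1234.vals = cfVal '' Dset := by
  ext x
  constructor
  · rintro ⟨θ, hθ, -, -, rfl⟩
    exact mem_image_of_mem _ hθ
  · rintro ⟨θ, hθ, rfl⟩
    exact ⟨θ, hθ, (isDigitSeq_of_mem_Dset hθ 0).1, (isDigitSeq_of_mem_Dset hθ 0).2, rfl⟩

/-- The two Cantor sets of the theorem, before applying `x ↦ [0; bW n, x]`. -/
theorem image_add_image (f : Mob) (hdet : f.p' * f.q - f.p * f.q' = 1) :
    ((f.push 1).push 4).ev '' (cfVal '' Dtil) + ((f.push 1).push 3).ev '' (cfVal '' Dset) =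
      Icc (((f.push 1).push 4).ev (1 - omax) + ((f.push 1).push 3).ev (1 - omax))
        (((f.push 1).push 4).ev (1 - omax / 3) + ((f.push 1).push 3).ev omax) := by
  have b1 := omax_gt
  have b2 := omax_lt
  have mI := Mob.monotoneOn_ev
    (f.det_push_push (d := 1) (e := 4) (by norm_num) (by norm_num) hdet)
  have mJ := Mob.monotoneOn_ev
    (f.det_push_push (d := 1) (e := 3) (by norm_num) (by norm_num) hdet)
  apply Subset.antisymm
  · rintro _ ⟨_, ⟨_, ⟨θ, hθ, rfl⟩, rfl⟩, _, ⟨_, ⟨η, hη, rfl⟩, rfl⟩, rfl⟩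
    have h1 := one_sub_omax_le_cfVal hθ.1
    have h2 := cfVal_le_of_ne hθ.1 hθ.2
    have h3 := one_sub_omax_le_cfVal hη
    have h4 := cfVal_le_omax hη
    have h5 : ∀ {x : ℝ}, 1 - omax ≤ x → x ∈ Ici (0 : ℝ) := fun h => by
      rw [mem_Ici]
      linarith
    exact ⟨add_le_add (mI (h5 le_rfl) (h5 h1) h1) (mJ (h5 le_rfl) (h5 h3) h3),
      add_le_add (mI (h5 h1) (h5 (by linarith)) h2) (mJ (h5 h3) (h5 (by linarith)) h4)⟩
  · have h := Icc_subset_closure_image_add f hdet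
    rwa [vals_d1234, IsClosed.closure_eq] at h
    exact ((isCompact_image_cfVal isCompact_Dtil (sep_subset _ _) _).add
      (isCompact_image_cfVal isCompact_Dset Subset.rfl _)).isClosed

lemma image_cfVal_app {w : List ℕ} {d e : ℕ} (hw : ∀ c ∈ w ++ [d, e], 1 ≤ c ∧ c ≤ 4)
    {f : Mob} (hf : ∀ x, 0 ≤ x → cfBranch w x = f.ev x) (hd : 1 ≤ d) (he : 1 ≤ e)
    {θ : ℕ → ℕ} (hθ : θ ∈ Dset) :
    cfVal (app (w ++ [d, e]) θ) = ((f.push d hd).push e he).ev (cfVal θ) := by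
  have h := one_fifth_le_cfVal (isDigitSeq_of_mem_Dset hθ)
  rw [cfVal_app hw (isDigitSeq_of_mem_Dset hθ), cfBranch_append_pair f hf hd he (by linarith)]

lemma digit_of_mem_bW_append {n e c : ℕ} (he : 1 ≤ e ∧ e ≤ 4) (h : c ∈ bW n ++ [1, e]) :
    1 ≤ c ∧ c ≤ 4 := by
  rw [List.mem_append] at h
  rcases h with h | h
  · exact digit_of_mem_bW h
  · simp only [List.mem_cons, List.not_mem_nil, or_false] at h
    omega

lemma Ktil_bW_succ {n : ℕ} {f : Mob} (hf : ∀ x, 0 ≤ x → cfBranch (bW n) x = f.ev x) :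
    Ktil (bW (n + 1)) = ((f.push 1).push 4).ev '' (cfVal '' Dtil) := by
  rw [bW_succ]
  have hw : ∀ c ∈ bW n ++ [1, 4], 1 ≤ c ∧ c ≤ 4 := fun c => digit_of_mem_bW_append (by norm_num)
  ext x
  constructor
  · rintro ⟨θ, hθ, -, h13, rfl⟩
    exact ⟨_, ⟨θ, ⟨hθ, h13⟩, rfl⟩, (image_cfVal_app hw hf _ _ hθ).symm⟩
  · rintro ⟨_, ⟨θ, ⟨hθ, h13⟩, rfl⟩, rfl⟩
    exact ⟨θ, hθ, by simp [badPairs], h13, (image_cfVal_app hw hf _ _ hθ).symm⟩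

lemma Kb_cW_succ {n : ℕ} {f : Mob} (hf : ∀ x, 0 ≤ x → cfBranch (bW n) x = f.ev x) :
    Kb (cW (n + 1)) = ((f.push 1).push 3).ev '' (cfVal '' Dset) := by
  have hw : ∀ c ∈ bW n ++ [1, 3], 1 ≤ c ∧ c ≤ 4 := fun c => digit_of_mem_bW_append (by norm_num)
  ext x
  simp only [cW, Nat.add_sub_cancel]
  constructor
  · rintro ⟨θ, hθ, -, rfl⟩
    exact ⟨_, ⟨θ, hθ, rfl⟩, (image_cfVal_app hw hf _ _ hθ).symm⟩
  · rintro ⟨_, ⟨θ, hθ, rfl⟩, rfl⟩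
    exact ⟨θ, hθ, by simp [badPairs], (image_cfVal_app hw hf _ _ hθ).symm⟩

lemma cfVal_app_append {v w : List ℕ} {θ : ℕ → ℕ} (hv : ∀ d ∈ v, 1 ≤ d ∧ d ≤ 4)
    (hw : ∀ d ∈ w, 1 ≤ d ∧ d ≤ 4) (hθ : IsDigitSeq θ) :
    cfVal (app (v ++ w) θ) = cfBranch v (cfBranch w (cfVal θ)) := by
  rw [cfVal_app (fun d hd => (List.mem_append.1 hd).elim (hv d) (hw d)) hθ, cfBranch_append]

lemma cfBranch_four_omax : cfBranch [4] omax = 1 - omax := by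
  have := omax_gt
  change 1 / (((4 : ℕ) : ℝ) + omax) = _
  push_cast
  rw [div_eq_iff (by linarith)]
  linarith [omax_sq]

lemma cfBranch_one_two_omax : cfBranch [1, 2] omax = 1 - omax / 3 := by
  have := omax_gt
  have h : (1 : ℝ) / (((2 : ℕ) : ℝ) + omax) = (omax + 1) / 5 := by
    push_cast
    rw [div_eq_div_iff (by linarith) (by norm_num)]
    linarith [omax_sq]
  change 1 / (((1 : ℕ) : ℝ) + 1 / (((2 : ℕ) : ℝ) + omax)) = _
  rw [h]
  push_cast
  rw [div_eq_iff (by linarith)]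
  linarith [omax_sq]

theorem Ktil_bW_add_Kb_cW (n : ℕ) :
    Ktil (bW (n + 1)) + Kb (cW (n + 1)) =
      Icc (cfVal (app (bW (n + 1) ++ [4]) per13) + cfVal (app (cW (n + 1) ++ [4]) per13))
        (cfVal (app (bW (n + 1) ++ [1, 2]) per13) + cfVal (app (cW (n + 1)) per13)) := by
  obtain ⟨f, hdet, hf⟩ := exists_mob_bW n
  have b1 := omax_gt
  have b2 := omax_lt
  have hd := isDigitSeq_of_mem_Dset per13_mem_Dset
  have hb : ∀ c ∈ bW n ++ [1, 4], 1 ≤ c ∧ c ≤ 4 := fun c => digit_of_mem_bW_append (by norm_num)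
  have hc : ∀ c ∈ bW n ++ [1, 3], 1 ≤ c ∧ c ≤ 4 := fun c => digit_of_mem_bW_append (by norm_num)
  rw [Ktil_bW_succ hf, Kb_cW_succ hf, image_add_image f hdet, bW_succ, cW, Nat.add_sub_cancel,
    cfVal_app_append hb (by simp) hd, cfVal_app_append hb (by simp) hd,
    cfVal_app_append hc (by simp) hd, cfVal_app hc hd]
  change _ = Icc (cfBranch (bW n ++ [1, 4]) (cfBranch [4] omax) +
    cfBranch (bW n ++ [1, 3]) (cfBranch [4] omax))
    (cfBranch (bW n ++ [1, 4]) (cfBranch [1, 2] omax) + cfBranch (bW n ++ [1, 3]) omax)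
  rw [cfBranch_four_omax, cfBranch_one_two_omax]
  simp only [cfBranch_append_pair f hf (le_refl 1) (by norm_num : 1 ≤ 4)
      (by linarith : 0 ≤ 1 - omax),
    cfBranch_append_pair f hf (le_refl 1) (by norm_num : 1 ≤ 4) (by linarith : 0 ≤ 1 - omax / 3),
    cfBranch_append_pair f hf (le_refl 1) (by norm_num : 1 ≤ 3) (by linarith : 0 ≤ 1 - omax),
    cfBranch_append_pair f hf (le_refl 1) (by norm_num : 1 ≤ 3) (by linarith : 0 ≤ omax)]

lemma cfVal_app_pair_append {d e : ℕ} (hd : 1 ≤ d ∧ d ≤ 4) (he : 1 ≤ e ∧ e ≤ 4) {w : List ℕ}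
    (hw : ∀ c ∈ w, 1 ≤ c ∧ c ≤ 4) :
    cfVal (app ([d, e] ++ w) per13) = 1 / (d + 1 / (e + cfBranch w omax)) := by
  rw [cfVal_app_append (by simp [hd, he]) hw (isDigitSeq_of_mem_Dset per13_mem_Dset)]
  rfl

lemma one_div_one_add_one_div {y : ℝ} (hy : 0 < y) : 1 / (1 + 1 / y) = 1 - 1 / (y + 1) := by
  field_simp
  ring

/-- For every `s ≥ 1`, `K̃(b^s) + K(c^s)` is the closed interval
`[[0; b^s,4,\overline{1,3}] + [0; c^s,4,\overline{1,3}],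
  [0; b^s,1,2,\overline{1,3}] + [0; c^s,\overline{1,3}]]`.
In particular, for `s = 1`, `K(1,3) + K̃(1,4)` is the interval
`[[0;1,3,4,\overline{1,3}] + [0;1,4,4,\overline{1,3}],
  [0;\overline{1,3}] + [0;1,4,1,2,\overline{1,3}]] = [1.57041…, 1.61695…]`. -/
theorem sum_Ktilbs_Kcs :
    (∀ s : ℕ, 1 ≤ s →
      Ktil (bW s) + Kb (cW s) =
        Set.Icc
          (cfVal (app (bW s ++ [4]) per13) + cfVal (app (cW s ++ [4]) per13))
          (cfVal (app (bW s ++ [1, 2]) per13) + cfVal (app (cW s) per13))) ∧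
    Kb [1, 3] + Ktil [1, 4] =
      Set.Icc
        (cfVal (app [1, 3, 4] per13) + cfVal (app [1, 4, 4] per13))
        (cfVal per13 + cfVal (app [1, 4, 1, 2] per13)) ∧
    cfVal (app [1, 3, 4] per13) + cfVal (app [1, 4, 4] per13) ∈
      Set.Ico (1.57041 : ℝ) 1.57042 ∧
    cfVal per13 + cfVal (app [1, 4, 1, 2] per13) ∈
      Set.Ico (1.61695 : ℝ) 1.61696 := by
  have b1 := omax_gt
  have b2 := omax_lt
  refine ⟨fun s hs => ?_, ?_, ?_, ?_⟩
  · obtain ⟨n, rfl⟩ := Nat.exists_eq_add_of_le' hs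
    exact Ktil_bW_add_Kb_cW n
  · have h := Ktil_bW_add_Kb_cW 0
    rw [add_comm, add_comm (cfVal (app (bW (0 + 1) ++ [4]) per13)),
      add_comm (cfVal (app (bW (0 + 1) ++ [1, 2]) per13))] at h
    simpa [bW, cW, per13_eq_app] using h
  · rw [show [1, 3, 4] = [1, 3] ++ [4] from rfl, show [1, 4, 4] = [1, 4] ++ [4] from rfl,
      cfVal_app_pair_append (by norm_num) (by norm_num) (by simp),
      cfVal_app_pair_append (by norm_num) (by norm_num) (by simp), cfBranch_four_omax]
    push_cast
    rw [one_div_one_add_one_div (by linarith), one_div_one_add_one_div (by linarith)]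
    have h1 : 0.237602 < 1 / (3 + (1 - omax) + 1) := by
      rw [lt_div_iff₀ (by linarith)]
      linarith
    have h2 : 1 / (3 + (1 - omax) + 1) < 0.237603 := by
      rw [div_lt_iff₀ (by linarith)]
      linarith
    have h3 : 0.191986 < 1 / (4 + (1 - omax) + 1) := by
      rw [lt_div_iff₀ (by linarith)]
      linarith
    have h4 : 1 / (4 + (1 - omax) + 1) < 0.191987 := by
      rw [div_lt_iff₀ (by linarith)]
      linarith
    constructor <;> linarith
  · rw [show [1, 4, 1, 2] = [1, 4] ++ [1, 2] from rfl,
      cfVal_app_pair_append (by norm_num) (by norm_num) (by simp), cfBranch_one_two_omax]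
    push_cast
    rw [one_div_one_add_one_div (by linarith)]
    change omax + _ ∈ _
    have h1 : 0.174330 < 1 / (4 + (1 - omax / 3) + 1) := by
      rw [lt_div_iff₀ (by linarith)]
      linarith
    have h2 : 1 / (4 + (1 - omax / 3) + 1) < 0.174332 := by
      rw [div_lt_iff₀ (by linarith)]
      linarith
    constructor <;> linarith
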